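/- arXiv:2110.12600 — 3 statements merged into one kernel-verified Lean document; each statement's English description precedes it below -/
import Mathlib

section
/- Let q ∈ (5/2, 10/3), ρ > 0, and let u ∈ H^1(B_ρ; ℝ^5) where B_ρ ⊂ ℝ^5 is the ball of radius ρ centered at the origin. Let a ∈ (0,1) be such that q + 3aq − 10a > 0. Then there is a constant N = N(a,q) > 0 such that ∫_{B_ρ}|u|^3 dx ≤ N ρ² [ A(ρ)^{(q+3aq−10a)/(4q)} C(ρ)^{a/q} E(ρ)^{5(q−aq+2a)/(4q)} + A(ρ)^{(3−a)/2} C(ρ)^{a/q} ], where A(ρ) = ρ^{−3}∫_{B_ρ}|u|² dx, C(ρ) = ρ^{q−5}∫_{B_ρ}|u|^q dx, and E(ρ) = ρ^{−1}∫_{B_ρ}|∇u|² dx. -/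
open MeasureTheory Metric Real NNReal

noncomputable section

/-- Five dimensional Euclidean space. -/
abbrev E5 := EuclideanSpace ℝ (Fin 5)

/-- Standard basis vector. -/
def eb (i : Fin 5) : E5 := EuclideanSpace.single i 1

/-- Euclidean inner product on `E5`. -/
def inner5 (a b : E5) : ℝ := ∑ i : Fin 5, a i * b i

/-- `|∇u|²`, the squared (Frobenius) norm of the gradient of a vector field. -/
def gradNormSq (u : E5 → E5) (x : E5) : ℝ :=
  ∑ i : Fin 5, ‖fderiv ℝ u x (eb i)‖ ^ 2

/-- Divergence of a vector field. -/
def divg (u : E5 → E5) (x : E5) : ℝ :=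
  ∑ i : Fin 5, fderiv ℝ u x (eb i) i

/-- Laplacian of a scalar function. -/
def lap (ψ : E5 → ℝ) (x : E5) : ℝ :=
  ∑ i : Fin 5, fderiv ℝ (fun y => fderiv ℝ ψ y (eb i)) x (eb i)

/-- The unit ball `B_1 ⊆ ℝ⁵`. -/
def B1 : Set E5 := ball 0 1

/-- The open upper half space `{x₅ > 0}`. -/
def upperHalf : Set E5 := {x : E5 | 0 < x 4}

/-- The unit upper half ball `B_1⁺`. -/
def B1p : Set E5 := B1 ∩ upperHalf

/-- The upper half ball `B⁺(x₀, r)`. -/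
def Bp (x0 : E5) (r : ℝ) : Set E5 := ball x0 r ∩ upperHalf

/-- Average of a function over a set (w.r.t. Lebesgue measure). -/
def avgOn (s : Set E5) (g : E5 → ℝ) : ℝ := ⨍ x in s, g x

/-- `(u, p)` is a suitable weak solution of the 5D stationary Navier-Stokes equations
`u·∇u − Δu + ∇p = f`, `div u = 0` in the unit ball `B_1`. -/
structure IsSWS (u : E5 → E5) (p : E5 → ℝ) (f : E5 → E5) : Prop where
  u_diff : ∀ x ∈ B1, DifferentiableAt ℝ u x
  u_L2 : IntegrableOn (fun x => ‖u x‖ ^ 2) B1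
  grad_L2 : IntegrableOn (gradNormSq u) B1
  p_L1 : IntegrableOn p B1
  div_free : ∀ x ∈ B1, divg u x = 0
  pde : ∀ φ : E5 → E5, ContDiff ℝ (⊤ : ℕ∞) φ → HasCompactSupport φ → tsupport φ ⊆ B1 →
    ∫ x in B1, (inner5 (fderiv ℝ u x (u x)) (φ x)
      + ∑ i : Fin 5, inner5 (fderiv ℝ u x (eb i)) (fderiv ℝ φ x (eb i))
      - p x * divg φ x - inner5 (f x) (φ x)) = 0
  energy : ∀ ψ : E5 → ℝ, ContDiff ℝ (⊤ : ℕ∞) ψ → (∀ x, 0 ≤ ψ x) →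
    HasCompactSupport ψ → tsupport ψ ⊆ B1 →
    2 * ∫ x in B1, gradNormSq u x * ψ x ≤
      ∫ x in B1, (‖u x‖ ^ 2 * lap ψ x
        + (‖u x‖ ^ 2 + 2 * p x) * inner5 (u x) (gradient ψ x)
        + 2 * inner5 (f x) (u x) * ψ x)

/-- `(u, p)` is a suitable weak solution of the 5D stationary Navier-Stokes equations in the
unit upper half ball `B_1⁺`, with zero Dirichlet condition on the flat boundary portion
`B_1 ∩ {x₅ = 0}`.  Test functions for the local energy inequality may be nonzero on the flat
boundary but vanish near the curved boundary. -/
structure IsSWSHalf (u : E5 → E5) (p : E5 → ℝ) (f : E5 → E5) : Prop where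
  u_diff : ∀ x ∈ B1p, DifferentiableAt ℝ u x
  u_L2 : IntegrableOn (fun x => ‖u x‖ ^ 2) B1p
  grad_L2 : IntegrableOn (gradNormSq u) B1p
  p_L1 : IntegrableOn p B1p
  bc : ∀ x : E5, ‖x‖ < 1 → x 4 = 0 → u x = 0
  div_free : ∀ x ∈ B1p, divg u x = 0
  pde : ∀ φ : E5 → E5, ContDiff ℝ (⊤ : ℕ∞) φ → HasCompactSupport φ → tsupport φ ⊆ B1p →
    ∫ x in B1p, (inner5 (fderiv ℝ u x (u x)) (φ x)
      + ∑ i : Fin 5, inner5 (fderiv ℝ u x (eb i)) (fderiv ℝ φ x (eb i))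
      - p x * divg φ x - inner5 (f x) (φ x)) = 0
  energy : ∀ ψ : E5 → ℝ, ContDiff ℝ (⊤ : ℕ∞) ψ → (∀ x, 0 ≤ ψ x) →
    HasCompactSupport ψ → tsupport ψ ⊆ B1 →
    2 * ∫ x in B1p, gradNormSq u x * ψ x ≤
      ∫ x in B1p, (‖u x‖ ^ 2 * lap ψ x
        + (‖u x‖ ^ 2 + 2 * p x) * inner5 (u x) (gradient ψ x)
        + 2 * inner5 (f x) (u x) * ψ x)

/-- `A(x₀,r) = r⁻³ ∫_{B(x₀,r)} |u|²`. -/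
def qA (u : E5 → E5) (x0 : E5) (r : ℝ) : ℝ := (∫ x in ball x0 r, ‖u x‖ ^ 2) / r ^ 3

/-- `C(x₀,r) = r^{q−5} ∫_{B(x₀,r)} |u|^q`. -/
def qC (u : E5 → E5) (q : ℝ) (x0 : E5) (r : ℝ) : ℝ :=
  (∫ x in ball x0 r, ‖u x‖ ^ q) / r ^ (5 - q)

/-- `E(x₀,r) = r⁻¹ ∫_{B(x₀,r)} |∇u|²`. -/
def qE (u : E5 → E5) (x0 : E5) (r : ℝ) : ℝ := (∫ x in ball x0 r, gradNormSq u x) / r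

/-- `G(x₀,r) = r^{−(10−15c)/(4−c)} ∫_{B(x₀,r)} |p − (p)_{B(x₀,r)}|^{5(1+c)/(4−c)}`. -/
def qG (p : E5 → ℝ) (c : ℝ) (x0 : E5) (r : ℝ) : ℝ :=
  (∫ x in ball x0 r, |p x - avgOn (ball x0 r) p| ^ (5 * (1 + c) / (4 - c))) /
    r ^ ((10 - 15 * c) / (4 - c))

/-- `P(x₀,r) = r⁻³ ∫_{B(x₀,r)} |p − (p)_{B(x₀,r)}|`. -/
def qP (p : E5 → ℝ) (x0 : E5) (r : ℝ) : ℝ :=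
  (∫ x in ball x0 r, |p x - avgOn (ball x0 r) p|) / r ^ 3

/-- `F(x₀,r) = r ∫_{B(x₀,r)} |f|²`. -/
def qF (f : E5 → E5) (x0 : E5) (r : ℝ) : ℝ := r * ∫ x in ball x0 r, ‖f x‖ ^ 2

/-- `A⁺(x₀,r)`. -/
def qAp (u : E5 → E5) (x0 : E5) (r : ℝ) : ℝ := (∫ x in Bp x0 r, ‖u x‖ ^ 2) / r ^ 3

/-- `C⁺(x₀,r)`. -/
def qCp (u : E5 → E5) (q : ℝ) (x0 : E5) (r : ℝ) : ℝ :=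
  (∫ x in Bp x0 r, ‖u x‖ ^ q) / r ^ (5 - q)

/-- `E⁺(x₀,r)`. -/
def qEp (u : E5 → E5) (x0 : E5) (r : ℝ) : ℝ := (∫ x in Bp x0 r, gradNormSq u x) / r

/-- `G⁺(x₀,r)`. -/
def qGp (p : E5 → ℝ) (c : ℝ) (x0 : E5) (r : ℝ) : ℝ :=
  (∫ x in Bp x0 r, |p x - avgOn (Bp x0 r) p| ^ (5 * (1 + c) / (4 - c))) /
    r ^ ((10 - 15 * c) / (4 - c))

/-- `P⁺(x₀,r)`. -/
def qPp (p : E5 → ℝ) (x0 : E5) (r : ℝ) : ℝ :=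
  (∫ x in Bp x0 r, |p x - avgOn (Bp x0 r) p|) / r ^ 3

/-- `F⁺(x₀,r)`. -/
def qFp (f : E5 → E5) (x0 : E5) (r : ℝ) : ℝ := r * ∫ x in Bp x0 r, ‖f x‖ ^ 2

/-- `u` agrees a.e. on `s` with a function that is Hölder continuous on `s`. -/
def HolderPiece (u : E5 → E5) (s : Set E5) : Prop :=
  ∃ (v : E5 → E5) (C α : ℝ≥0), 0 < α ∧ (α : ℝ) ≤ 1 ∧ HolderOnWith C α v s ∧
    (∀ᵐ x ∂(volume.restrict s), u x = v x)

open scoped ENNReal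

/-- A differentiable function is bounded by the integral of itself and its derivative along a
segment. -/
theorem enorm_le_lintegral_segment {E : Type*} [NormedAddCommGroup E] [NormedSpace ℝ E]
    {g : E → ℝ} {l : ℝ} (hl : 0 < l) {x v : E}
    (hg : ∀ t ∈ Set.Icc 0 l, DifferentiableAt ℝ g (x + t • v)) :
    ‖g x‖ₑ ≤ ∫⁻ t in Set.Ioc 0 l,
      (‖g (x + t • v)‖ₑ / ENNReal.ofReal l + ‖fderiv ℝ g (x + t • v) v‖ₑ) := by
  set h : ℝ → ℝ := fun t => (1 - t / l) * g (x + t • v) with hh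
  have hd : ∀ t ∈ Set.Icc 0 l, HasDerivAt h
      (-(1 / l) * g (x + t • v) + (1 - t / l) * fderiv ℝ g (x + t • v) v) t := by
    intro t ht
    have h1 : HasDerivAt (fun t : ℝ => 1 - t / l) (-(1 / l)) t :=
      ((hasDerivAt_id t).div_const l).const_sub 1
    have h2 : HasDerivAt (fun t : ℝ => x + t • v) v t := by
      simpa using ((hasDerivAt_id t).smul_const v).const_add x
    exact h1.mul ((hg t ht).hasFDerivAt.comp_hasDerivAt t h2)
  have hle : ∀ t ∈ Set.Ioc 0 l, ‖deriv h t‖ₑ ≤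
      ‖g (x + t • v)‖ₑ / ENNReal.ofReal l + ‖fderiv ℝ g (x + t • v) v‖ₑ := by
    intro t ht
    rw [(hd t (Set.Ioc_subset_Icc_self ht)).deriv]
    refine (enorm_add_le _ _).trans (add_le_add ?_ ?_)
    · rw [enorm_mul, enorm_neg, one_div, enorm_inv hl.ne', Real.enorm_of_nonneg hl.le,
        div_eq_mul_inv, mul_comm]
    · rw [enorm_mul]
      refine mul_le_of_le_one_left' ?_
      have h0 : 0 ≤ t / l := div_nonneg ht.1.le hl.le
      have h1 : t / l ≤ 1 := (div_le_one hl).2 ht.2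
      rw [Real.enorm_of_nonneg (by linarith)]
      exact ENNReal.ofReal_le_one.2 (by linarith)
  refine le_trans ?_ (setLIntegral_mono' measurableSet_Ioc hle)
  by_cases hfin : ∫⁻ t in Set.Ioc 0 l, ‖deriv h t‖ₑ = ∞
  · rw [hfin]; exact le_top
  have hint : IntervalIntegrable (deriv h) volume 0 l := by
    rw [intervalIntegrable_iff_integrableOn_Ioc_of_le hl.le]
    exact ⟨(measurable_deriv h).aestronglyMeasurable, lt_top_iff_ne_top.2 hfin⟩
  have hftc := intervalIntegral.integral_eq_sub_of_hasDerivAt (f := h) (f' := deriv h)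
    (a := 0) (b := l) (fun t ht => by
      rw [Set.uIcc_of_le hl.le] at ht
      exact (hd t ht).differentiableAt.hasDerivAt) hint
  rw [intervalIntegral.integral_of_le hl.le] at hftc
  have hgx : g x = -∫ t in Set.Ioc 0 l, deriv h t := by
    rw [hftc]; simp [hh, hl.ne']
  rw [hgx, enorm_neg]
  exact enorm_integral_le_lintegral_enorm _

/-- The linear map whose columns are the directions `-(s/2) e_j` and `-(s/2) e_j + (1/4) e_i`. -/
def coneFrameLin (j : Fin 5) (s : ℝ) : (Fin 5 → ℝ) →ₗ[ℝ] E5 where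
  toFun y := WithLp.toLp 2 fun i => if i = j then -(s / 2) * ∑ k, y k else y i / 4
  map_add' y z := by
    ext i
    by_cases h : i = j <;> simp [h, Finset.sum_add_distrib] <;> ring
  map_smul' c y := by
    ext i
    by_cases h : i = j <;> simp [h, ← Finset.mul_sum] <;> ring

theorem coneFrameLin_injective (j : Fin 5) {s : ℝ} (hs : s ≠ 0) :
    Function.Injective (coneFrameLin j s) := by
  rw [← LinearMap.ker_eq_bot, LinearMap.ker_eq_bot']
  intro y hy
  have hy' : ∀ i, (if i = j then -(s / 2) * ∑ k, y k else y i / 4) = 0 := fun i =>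
    congrArg (fun z : E5 => z i) hy
  have hne : ∀ i, i ≠ j → y i = 0 := fun i hi => by
    have := hy' i
    simp only [hi, if_false] at this
    linarith
  have hj := hy' j
  rw [if_pos rfl, Finset.sum_eq_single j (fun i _ hi => hne i hi) (by simp)] at hj
  ext i
  by_cases hi : i = j
  · subst hi
    simpa [hs] using hj
  · exact hne i hi

/-- `coneFrameLin` as a continuous linear equivalence. -/
def coneFrame (j : Fin 5) {s : ℝ} (hs : s ≠ 0) : (Fin 5 → ℝ) ≃L[ℝ] E5 :=
  ((coneFrameLin j s).linearEquivOfInjective (coneFrameLin_injective j hs)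
    (by simp)).toContinuousLinearEquiv

theorem coneFrame_single_apply (j : Fin 5) {s : ℝ} (hs : s ≠ 0) (i k : Fin 5) :
    coneFrame j hs (Pi.single i 1) k =
      if k = j then -(s / 2) else (Pi.single i (1 : ℝ) : Fin 5 → ℝ) k / 4 := by
  have h : coneFrame j hs (Pi.single i 1) k =
      if k = j then -(s / 2) * ∑ m, (Pi.single i (1 : ℝ) : Fin 5 → ℝ) m
        else (Pi.single i (1 : ℝ) : Fin 5 → ℝ) k / 4 := rfl
  rw [h]
  simp

theorem norm_coneFrame_single_sq_le (j : Fin 5) {s : ℝ} (hs : s ≠ 0) (hs1 : s ^ 2 = 1)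
    (i : Fin 5) : ‖coneFrame j hs (Pi.single i 1)‖ ^ 2 ≤ 5 / 16 := by
  rw [EuclideanSpace.norm_sq_eq]
  simp only [coneFrame_single_apply, Real.norm_eq_abs, sq_abs]
  have h : ∀ k : Fin 5, (if k = j then -(s / 2) else (Pi.single i (1 : ℝ) : Fin 5 → ℝ) k / 4) ^ 2 ≤
      (Pi.single j (1 / 4) : Fin 5 → ℝ) k + (Pi.single i (1 / 16) : Fin 5 → ℝ) k := by
    intro k
    by_cases hk : k = j <;> by_cases hi : k = i <;> simp [Pi.single_apply, hk, hi] <;>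
      split_ifs <;> nlinarith
  refine (Finset.sum_le_sum fun k _ => h k).trans ?_
  rw [Finset.sum_add_distrib]
  simp
  norm_num

theorem inner_coneFrame_single_le {x : E5} {j : Fin 5} {s : ℝ} (hs : s ≠ 0)
    (hx : ∀ k, |x k| ≤ s * x j) (i : Fin 5) :
    inner ℝ x (coneFrame j hs (Pi.single i 1)) ≤ -(s * x j) / 4 := by
  have h : inner ℝ x (coneFrame j hs (Pi.single i 1)) =
      ∑ k, x k * (if k = j then -(s / 2) else (Pi.single i (1 : ℝ) : Fin 5 → ℝ) k / 4) := by
    simp only [PiLp.inner_apply, coneFrame_single_apply]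
    exact Finset.sum_congr rfl fun k _ => by simp [mul_comm]
  have hle : ∀ k, x k * (if k = j then -(s / 2) else (Pi.single i (1 : ℝ) : Fin 5 → ℝ) k / 4) ≤
      (Pi.single j (-(s * x j) / 2) : Fin 5 → ℝ) k + (Pi.single i (s * x j / 4) : Fin 5 → ℝ) k := by
    intro k
    have h0 := (abs_nonneg _).trans (hx k)
    have h1 := (le_abs_self _).trans (hx k)
    by_cases hk : k = j
    · subst hk
      by_cases hi : k = i
      · subst hi; simp; linarith
      · simp [hi]; linarith
    · by_cases hi : k = i
      · subst hi; simp [hk]; linarith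
      · simp [hk, hi]
  rw [h]
  refine (Finset.sum_le_sum fun k _ => hle k).trans ?_
  rw [Finset.sum_add_distrib]
  simp
  linarith

/-- If `s * x j = max |x k|`, the segments of length proportional to `r` from `x` in the directions
of the frame stay in the ball of radius `r`. -/
theorem add_smul_coneFrame_mem_ball {x : E5} {r : ℝ} (hx : x ∈ ball (0 : E5) r) {j : Fin 5}
    {s : ℝ} (hs : s ≠ 0) (hs1 : s ^ 2 = 1) (hxj : ∀ k, |x k| ≤ s * x j) (i : Fin 5) {t : ℝ}
    (ht : t ∈ Set.Icc 0 (r / 4)) :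
    x + t • coneFrame j hs (Pi.single i 1) ∈ ball (0 : E5) r := by
  rw [mem_ball_zero_iff] at hx ⊢
  have hr : 0 < r := (norm_nonneg x).trans_lt hx
  refine lt_of_pow_lt_pow_left₀ 2 hr.le ?_
  set v := coneFrame j hs (Pi.single i 1)
  have hv : ‖v‖ ^ 2 ≤ 5 / 16 := norm_coneFrame_single_sq_le j hs hs1 i
  have hin : inner ℝ x v ≤ -(s * x j) / 4 := inner_coneFrame_single_le hs hxj i
  set m := s * x j with hm
  have hm0 : 0 ≤ m := (abs_nonneg _).trans (hxj j)
  have hx5 : ‖x‖ ^ 2 ≤ 5 * m ^ 2 := by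
    rw [EuclideanSpace.norm_sq_eq]
    calc ∑ k, ‖x k‖ ^ 2 ≤ ∑ _k : Fin 5, m ^ 2 :=
          Finset.sum_le_sum fun k _ => pow_le_pow_left₀ (norm_nonneg _) (hxj k) 2
      _ = 5 * m ^ 2 := by simp
  have hxr : ‖x‖ ^ 2 < r ^ 2 := pow_lt_pow_left₀ hx (norm_nonneg x) two_ne_zero
  obtain ⟨ht0, ht1⟩ := ht
  have hexp : ‖x + t • v‖ ^ 2 = ‖x‖ ^ 2 + 2 * t * inner ℝ x v + t ^ 2 * ‖v‖ ^ 2 := by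
    rw [norm_add_sq_real, inner_smul_right, norm_smul, mul_pow, Real.norm_eq_abs, sq_abs]
    ring
  have hle : ‖x + t • v‖ ^ 2 ≤ ‖x‖ ^ 2 - t * m / 2 + 5 / 16 * t ^ 2 := by
    rw [hexp]
    nlinarith [mul_le_mul_of_nonneg_left hin ht0, mul_le_mul_of_nonneg_left hv (sq_nonneg t)]
  by_cases hc : t ≤ 8 / 5 * m
  · nlinarith [mul_le_mul_of_nonneg_left hc ht0]
  · push Not at hc
    have hmr : m ≤ 5 / 32 * r := by linarith
    nlinarith [mul_nonneg ht0 hm0]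

/-- The Loomis-Whitney type inequality for lines in the directions of an arbitrary basis. -/
theorem exists_lintegral_prod_line_le (L : (Fin 5 → ℝ) ≃L[ℝ] E5) :
    ∃ K : ℝ≥0∞, K ≠ ∞ ∧ ∀ f : E5 → ℝ≥0∞, Measurable f →
      ∫⁻ x, ∏ i, (∫⁻ t : ℝ, f (x + t • L (Pi.single i 1))) ^ ((1 : ℝ) / 4) ≤
        K * (∫⁻ x, f x) ^ ((5 : ℝ) / 4) := by
  have := L.isAddHaarMeasure_map (volume : Measure (Fin 5 → ℝ))
  set ν := Measure.map L (volume : Measure (Fin 5 → ℝ))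
  have h1 := Measure.isAddLeftInvariant_eq_smul (volume : Measure E5) ν
  have h2 := Measure.isAddLeftInvariant_eq_smul ν (volume : Measure E5)
  set c := (volume : Measure E5).addHaarScalarFactor ν
  set d := ν.addHaarScalarFactor (volume : Measure E5)
  refine ⟨c * (d : ℝ≥0∞) ^ ((5 : ℝ) / 4), by finiteness, fun f hf => ?_⟩
  have hL : MeasurableEmbedding L := L.toHomeomorph.measurableEmbedding
  have hmap : ∀ F : E5 → ℝ≥0∞, ∫⁻ x, F x ∂ν = ∫⁻ y, F (L y) := fun F => hL.lintegral_map F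
  have hline : ∀ (y : Fin 5 → ℝ) (i : Fin 5),
      ∫⁻ t : ℝ, f (L y + t • L (Pi.single i 1)) = ∫⁻ t : ℝ, f (L (Function.update y i t)) := by
    intro y i
    rw [← lintegral_add_left_eq_self (fun t => f (L (Function.update y i t))) (y i)]
    refine lintegral_congr fun t => ?_
    rw [← map_smul, ← map_add]
    congr 2
    ext k
    by_cases hk : k = i
    · subst hk; simp
    · simp [hk]
  have hp : Real.HolderConjugate (Fintype.card (Fin 5)) ((5 : ℝ) / 4) := by
    rw [Real.holderConjugate_iff]; norm_num
  have hgrid := lintegral_prod_lintegral_pow_le (fun _ : Fin 5 => (volume : Measure ℝ)) hp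
    (f := fun y => f (L y)) (hf.comp L.continuous.measurable)
  rw [← volume_pi] at hgrid
  calc ∫⁻ x, ∏ i, (∫⁻ t : ℝ, f (x + t • L (Pi.single i 1))) ^ ((1 : ℝ) / 4)
      = c * ∫⁻ y, ∏ i, (∫⁻ t : ℝ, f (L (Function.update y i t))) ^ ((1 : ℝ) / 4) := by
        conv_lhs => rw [h1]
        rw [lintegral_smul_measure, hmap]
        simp only [hline]
        rfl
    _ ≤ c * (∫⁻ y, f (L y)) ^ ((5 : ℝ) / 4) := by
        gcongr
        have hcard : ((Fintype.card (Fin 5) : ℝ) - 1) = 4 := by norm_num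
        rwa [hcard] at hgrid
    _ = c * (d : ℝ≥0∞) ^ ((5 : ℝ) / 4) * (∫⁻ x, f x) ^ ((5 : ℝ) / 4) := by
        rw [← hmap, h2, lintegral_smul_measure, mul_assoc, ← ENNReal.mul_rpow_of_nonneg _ _ (by norm_num)]
        rfl

/-- The `W^{1,1}` to `L^{5/4}` Sobolev inequality on balls of `ℝ⁵`. -/
theorem exists_lintegral_ball_enorm_rpow_le :
    ∃ K : ℝ≥0∞, K ≠ ∞ ∧ ∀ (r : ℝ) (g : E5 → ℝ), 0 < r →
      (∀ x ∈ ball (0 : E5) r, DifferentiableAt ℝ g x) →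
      ∫⁻ x in ball (0 : E5) r, ‖g x‖ₑ ^ ((5 : ℝ) / 4) ≤
        K * (∫⁻ x in ball (0 : E5) r,
          (‖g x‖ₑ / ENNReal.ofReal (r / 4) + ‖fderiv ℝ g x‖ₑ)) ^ ((5 : ℝ) / 4) := by
  let sg : Bool → ℝ := fun b => cond b 1 (-1)
  have hsg : ∀ b, sg b ≠ 0 := by intro b; cases b <;> simp [sg]
  have hsg1 : ∀ b, sg b ^ 2 = 1 := by intro b; cases b <;> simp [sg]
  choose K hK hKf using fun k : Fin 5 × Bool =>
    exists_lintegral_prod_line_le (coneFrame k.1 (hsg k.2))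
  refine ⟨∑ k, K k, ENNReal.sum_ne_top.2 fun k _ => hK k, fun r g hr hg => ?_⟩
  set W : E5 → ℝ≥0∞ := fun x => ‖g x‖ₑ / ENNReal.ofReal (r / 4) + ‖fderiv ℝ g x‖ₑ with hW
  set f : E5 → ℝ≥0∞ := (ball (0 : E5) r).indicator W with hf
  have hgc : ContinuousOn g (ball (0 : E5) r) := fun x hx =>
    (hg x hx).continuousAt.continuousWithinAt
  have hfm : Measurable f := by
    have hgm : Measurable ((ball (0 : E5) r).indicator g) := by
      classical
      rw [← Set.piecewise_eq_indicator]
      exact hgc.measurable_piecewise continuous_zero.continuousOn measurableSet_ball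
    have : f = (ball (0 : E5) r).indicator fun x =>
        ‖(ball (0 : E5) r).indicator g x‖ₑ / ENNReal.ofReal (r / 4) + ‖fderiv ℝ g x‖ₑ := by
      ext x
      by_cases hx : x ∈ ball (0 : E5) r <;> simp only [hf, hW, Set.indicator, hx, if_true, if_false]
    rw [this]
    exact ((hgm.enorm.div_const _).add (measurable_fderiv ℝ g).enorm).indicator measurableSet_ball
  let P : Fin 5 × Bool → E5 → ℝ≥0∞ := fun k x =>
    ∏ i, (∫⁻ t : ℝ, f (x + t • coneFrame k.1 (hsg k.2) (Pi.single i 1))) ^ ((1 : ℝ) / 4)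
  have hPm : ∀ k, Measurable (P k) := by
    intro k
    refine Finset.measurable_prod _ fun i _ => Measurable.pow_const ?_ _
    refine Measurable.lintegral_prod_right' (f := fun z : E5 × ℝ =>
      f (z.1 + z.2 • coneFrame k.1 (hsg k.2) (Pi.single i 1))) ?_
    exact hfm.comp (by fun_prop)
  have hpt : ∀ x ∈ ball (0 : E5) r, ‖g x‖ₑ ^ ((5 : ℝ) / 4) ≤ ∑ k, P k x := by
    intro x hx
    obtain ⟨j, hj⟩ := Finite.exists_max fun k => |x k|
    obtain ⟨b, hb⟩ : ∃ b, sg b * x j = |x j| := by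
      rcases abs_choice (x j) with h | h
      · exact ⟨true, by simp [sg, h]⟩
      · exact ⟨false, by simp [sg, h]⟩
    have hmem := fun i t ht => add_smul_coneFrame_mem_ball hx (hsg b) (hsg1 b)
      (fun k => hb ▸ hj k) i (t := t) ht
    refine le_trans ?_ (Finset.single_le_sum (f := fun k => P k x) (fun _ _ => zero_le)
      (Finset.mem_univ (j, b)))
    have hone : ∀ i, ‖g x‖ₑ ≤ ∫⁻ t : ℝ, f (x + t • coneFrame j (hsg b) (Pi.single i 1)) := by
      intro i
      refine (enorm_le_lintegral_segment (l := r / 4) (by positivity)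
        fun t ht => hg _ (hmem i t ht)).trans ?_
      refine (setLIntegral_mono' measurableSet_Ioc fun t ht => ?_).trans
        (setLIntegral_le_lintegral (Set.Ioc 0 (r / 4)) _)
      rw [hf, Set.indicator_of_mem (hmem i t (Set.Ioc_subset_Icc_self ht))]
      refine add_le_add le_rfl ((ContinuousLinearMap.le_opENorm _ _).trans ?_)
      refine mul_le_of_le_one_right' ?_
      rw [← ofReal_norm]
      refine ENNReal.ofReal_le_one.2 ?_
      nlinarith [norm_coneFrame_single_sq_le j (hsg b) (hsg1 b) i,
        norm_nonneg (coneFrame j (hsg b) (Pi.single i 1))]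
    calc ‖g x‖ₑ ^ ((5 : ℝ) / 4) = ∏ _i : Fin 5, ‖g x‖ₑ ^ ((1 : ℝ) / 4) := by
          rw [Finset.prod_const, ← ENNReal.rpow_mul_natCast]
          norm_num
      _ ≤ P (j, b) x := Finset.prod_le_prod' fun i _ =>
          ENNReal.rpow_le_rpow (hone i) (by norm_num)
  calc ∫⁻ x in ball (0 : E5) r, ‖g x‖ₑ ^ ((5 : ℝ) / 4)
      ≤ ∫⁻ x in ball (0 : E5) r, ∑ k, P k x := setLIntegral_mono' measurableSet_ball hpt
    _ ≤ ∫⁻ x, ∑ k, P k x := setLIntegral_le_lintegral _ _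
    _ = ∑ k, ∫⁻ x, P k x := lintegral_finsetSum _ fun k _ => hPm k
    _ ≤ ∑ k, K k * (∫⁻ x, f x) ^ ((5 : ℝ) / 4) := Finset.sum_le_sum fun k _ => hKf k f hfm
    _ = _ := by rw [← Finset.sum_mul, hf, lintegral_indicator measurableSet_ball]

/-- The gradient of `‖u‖ ^ p` at a point where `u` is differentiable. -/
theorem enorm_fderiv_norm_rpow_le_of_differentiableAt {u : E5 → E5} {x : E5}
    (hu : DifferentiableAt ℝ u x) {p : ℝ} (hp : 1 < p) :
    ‖fderiv ℝ (fun y => ‖u y‖ ^ p) x‖ₑ ≤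
      ENNReal.ofReal p * ‖u x‖ₑ ^ (p - 1) * ‖fderiv ℝ u x‖ₑ := by
  have h := ((hasFDerivAt_norm_rpow (u x) hp).comp x hu.hasFDerivAt).fderiv
  have hle : ‖fderiv ℝ (fun y => ‖u y‖ ^ p) x‖ ≤ p * ‖u x‖ ^ (p - 1) * ‖fderiv ℝ u x‖ := by
    rw [show (fun y => ‖u y‖ ^ p) = (fun z => ‖z‖ ^ p) ∘ u from rfl, h]
    refine (ContinuousLinearMap.opNorm_comp_le _ _).trans ?_
    gcongr
    rw [norm_smul, innerSL_apply_norm, Real.norm_of_nonneg (by positivity), mul_assoc,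
      ← Real.rpow_add_one' (norm_nonneg _) (by linarith)]
    ring_nf
    exact le_rfl
  rw [← ofReal_norm, ← ofReal_norm (u x), ← ofReal_norm (fderiv ℝ u x),
    ENNReal.ofReal_rpow_of_nonneg (norm_nonneg _) (by linarith), ← ENNReal.ofReal_mul (by linarith),
    ← ENNReal.ofReal_mul (by positivity)]
  exact ENNReal.ofReal_le_ofReal hle

/-- The `W^{1,2}` to `L^{10/3}` Sobolev inequality on balls of `ℝ⁵`, for functions known to be in
`L^{10/3}`. -/
theorem exists_lintegral_ball_rpow_le_of_ne_top :
    ∃ K : ℝ≥0∞, K ≠ ∞ ∧ ∀ (r : ℝ) (u : E5 → E5), 0 < r →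
      (∀ x ∈ ball (0 : E5) r, DifferentiableAt ℝ u x) →
      ∫⁻ x in ball (0 : E5) r, ‖u x‖ₑ ^ ((10 : ℝ) / 3) ≠ ∞ →
      ∫⁻ x in ball (0 : E5) r, ‖u x‖ₑ ^ ((10 : ℝ) / 3) ≤
        K * (∫⁻ x in ball (0 : E5) r,
          (‖u x‖ₑ / ENNReal.ofReal (r / 4) + ‖fderiv ℝ u x‖ₑ) ^ (2 : ℝ)) ^ ((5 : ℝ) / 3) := by
  obtain ⟨K, hK, hKg⟩ := exists_lintegral_ball_enorm_rpow_le
  set c : ℝ≥0∞ := ENNReal.ofReal (8 / 3) with hc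
  refine ⟨(K * c ^ ((5 : ℝ) / 4)) ^ ((8 : ℝ) / 3), by finiteness, fun r u hr hu hX => ?_⟩
  set W : E5 → ℝ≥0∞ := fun x => ‖u x‖ₑ / ENNReal.ofReal (r / 4) + ‖fderiv ℝ u x‖ₑ with hW
  set μ := volume.restrict (ball (0 : E5) r)
  have hum : AEMeasurable (fun x => ‖u x‖ₑ) μ :=
    (ContinuousOn.aemeasurable (fun x hx => (hu x hx).continuousAt.continuousWithinAt)
      measurableSet_ball).enorm
  have hWm : AEMeasurable W μ :=
    (hum.div_const _).add (measurable_fderiv ℝ u).enorm.aemeasurable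
  have hg := hKg r (fun x => ‖u x‖ ^ ((8 : ℝ) / 3)) hr fun x hx =>
    (hasFDerivAt_norm_rpow (u x) (by norm_num)).differentiableAt.comp x (hu x hx)
  have hge : ∀ x, ‖‖u x‖ ^ ((8 : ℝ) / 3)‖ₑ = ‖u x‖ₑ ^ ((8 : ℝ) / 3) := fun x => by
    rw [Real.enorm_rpow_of_nonneg (norm_nonneg _) (by norm_num), enorm_norm]
  simp only [hge, ← ENNReal.rpow_mul] at hg
  norm_num only at hg
  set X := ∫⁻ x, ‖u x‖ₑ ^ ((10 : ℝ) / 3) ∂μ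
  set Y := ∫⁻ x, W x ^ (2 : ℝ) ∂μ
  have hWg : ∫⁻ x, (‖u x‖ₑ ^ ((8 : ℝ) / 3) / ENNReal.ofReal (r / 4) +
      ‖fderiv ℝ (fun x => ‖u x‖ ^ ((8 : ℝ) / 3)) x‖ₑ) ∂μ ≤
      c * (X ^ ((1 : ℝ) / 2) * Y ^ ((1 : ℝ) / 2)) := by
    calc _ ≤ ∫⁻ x, c * (‖u x‖ₑ ^ ((5 : ℝ) / 3) * W x) ∂μ := by
          refine setLIntegral_mono' measurableSet_ball fun x hx => ?_
          rw [hW, mul_add, mul_add]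
          refine add_le_add ?_ ?_
          · rw [show (8 : ℝ) / 3 = 5 / 3 + 1 by norm_num,
              ENNReal.rpow_add_of_nonneg _ _ (by norm_num) (by norm_num), ENNReal.rpow_one,
              mul_div_assoc]
            refine le_mul_of_one_le_left' ?_
            rw [hc, ENNReal.one_le_ofReal]
            norm_num
          · refine (enorm_fderiv_norm_rpow_le_of_differentiableAt (hu x hx)
              (by norm_num)).trans_eq ?_
            norm_num [mul_assoc, hc]
      _ = c * ∫⁻ x, ‖u x‖ₑ ^ ((5 : ℝ) / 3) * W x ∂μ :=
          lintegral_const_mul' _ _ ENNReal.ofReal_ne_top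
      _ ≤ c * (X ^ ((1 : ℝ) / 2) * Y ^ ((1 : ℝ) / 2)) := by
          gcongr
          refine (ENNReal.lintegral_mul_le_Lp_mul_Lq μ Real.HolderConjugate.two_two
            (hum.pow_const _) hWm).trans_eq ?_
          simp only [← ENNReal.rpow_mul]
          norm_num only [X, Y]
  have hmain : X ≤ K * c ^ ((5 : ℝ) / 4) * Y ^ ((5 : ℝ) / 8) * X ^ ((5 : ℝ) / 8) := by
    refine hg.trans ?_
    calc _ ≤ K * (c * (X ^ ((1 : ℝ) / 2) * Y ^ ((1 : ℝ) / 2))) ^ ((5 : ℝ) / 4) := by gcongr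
      _ = _ := by
        rw [ENNReal.mul_rpow_of_nonneg _ _ (by norm_num),
          ENNReal.mul_rpow_of_nonneg _ _ (by norm_num), ← ENNReal.rpow_mul, ← ENNReal.rpow_mul]
        norm_num only
        ring
  by_cases hX0 : X = 0
  · rw [hX0]; exact zero_le
  have hX38 : X ^ ((3 : ℝ) / 8) ≤ K * c ^ ((5 : ℝ) / 4) * Y ^ ((5 : ℝ) / 8) := by
    rw [← ENNReal.mul_le_mul_iff_left (c := X ^ ((5 : ℝ) / 8)) (by simp [hX0, hX])
      (by finiteness), ← ENNReal.rpow_add _ _ hX0 hX]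
    norm_num only [ENNReal.rpow_one]
    exact hmain
  calc X = (X ^ ((3 : ℝ) / 8)) ^ ((8 : ℝ) / 3) := by
        rw [← ENNReal.rpow_mul]; norm_num
    _ ≤ (K * c ^ ((5 : ℝ) / 4) * Y ^ ((5 : ℝ) / 8)) ^ ((8 : ℝ) / 3) := by gcongr
    _ = _ := by
        rw [ENNReal.mul_rpow_of_nonneg _ _ (by norm_num), ← ENNReal.rpow_mul Y]
        norm_num only

/-- The `W^{1,2}` to `L^{10/3}` Sobolev inequality on balls of `ℝ⁵`. -/
theorem exists_lintegral_ball_rpow_le :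
    ∃ K : ℝ≥0∞, K ≠ ∞ ∧ ∀ (r : ℝ) (u : E5 → E5), 0 < r →
      (∀ x ∈ ball (0 : E5) r, DifferentiableAt ℝ u x) →
      ∫⁻ x in ball (0 : E5) r, ‖u x‖ₑ ^ ((10 : ℝ) / 3) ≤
        K * (∫⁻ x in ball (0 : E5) r,
          (‖u x‖ₑ / ENNReal.ofReal r + ‖fderiv ℝ u x‖ₑ) ^ (2 : ℝ)) ^ ((5 : ℝ) / 3) := by
  obtain ⟨K, hK, hKu⟩ := exists_lintegral_ball_rpow_le_of_ne_top
  refine ⟨K * ((8 : ℝ≥0∞) ^ (2 : ℝ)) ^ ((5 : ℝ) / 3), by finiteness, fun r u hr hu => ?_⟩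
  obtain ⟨ρ, hρm, hρ, hρt⟩ := exists_seq_strictMono_tendsto' (half_lt_self hr)
  have hU : ball (0 : E5) r = ⋃ n, ball (0 : E5) (ρ n) := by
    ext x
    simp only [Set.mem_iUnion, mem_ball_zero_iff]
    exact ⟨fun hx => (hρt.eventually (lt_mem_nhds hx)).exists,
      fun ⟨n, hn⟩ => hn.trans (hρ n).2⟩
  have hdir : Directed (· ⊆ ·) fun n => ball (0 : E5) (ρ n) :=
    Monotone.directed_le fun _ _ hmn => ball_subset_ball (hρm.monotone hmn)
  conv_lhs => rw [hU, setLIntegral_iUnion_of_directed _ hdir]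
  refine iSup_le fun n => ?_
  obtain ⟨hn1, hn2⟩ := hρ n
  have hρ0 : 0 < ρ n := (half_pos hr).trans hn1
  have hcont : ContinuousOn u (closedBall (0 : E5) (ρ n)) := fun x hx =>
    (hu x (closedBall_subset_ball hn2 hx)).continuousAt.continuousWithinAt
  have hfin : ∫⁻ x in ball (0 : E5) (ρ n), ‖u x‖ₑ ^ ((10 : ℝ) / 3) ≠ ∞ := by
    obtain ⟨C, hC⟩ := (isCompact_closedBall (0 : E5) (ρ n)).exists_bound_of_continuousOn hcont
    refine ne_top_of_le_ne_top (b := ENNReal.ofReal C ^ ((10 : ℝ) / 3) * volume (ball (0 : E5) (ρ n)))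
      (ENNReal.mul_ne_top (by finiteness) measure_ball_lt_top.ne) ?_
    rw [← setLIntegral_const]
    refine setLIntegral_mono' measurableSet_ball fun x hx => ?_
    gcongr
    rw [← ofReal_norm]
    exact ENNReal.ofReal_le_ofReal (hC x (ball_subset_closedBall hx))
  refine (hKu (ρ n) u hρ0 (fun x hx => hu x (ball_subset_ball hn2.le hx)) hfin).trans ?_
  rw [mul_assoc, ← ENNReal.mul_rpow_of_nonneg _ _ (by norm_num),
    ← lintegral_const_mul' _ _ (by finiteness)]
  gcongr K * ?_ ^ _
  refine (setLIntegral_mono' measurableSet_ball fun x _ => ?_).trans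
    (lintegral_mono_set (ball_subset_ball hn2.le))
  rw [← ENNReal.mul_rpow_of_nonneg _ _ (by norm_num), mul_add]
  gcongr
  · have h8 : (8 : ℝ≥0∞) = ENNReal.ofReal 8 := by norm_num
    rw [ENNReal.div_eq_inv_mul, ENNReal.div_eq_inv_mul, ← mul_assoc]
    gcongr
    rw [← ENNReal.ofReal_inv_of_pos (by positivity), ← ENNReal.ofReal_inv_of_pos hr, h8,
      ← ENNReal.ofReal_mul (by norm_num)]
    refine ENNReal.ofReal_le_ofReal ?_
    rw [inv_div, ← div_eq_mul_inv, div_le_div_iff₀ hρ0 hr]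
    linarith
  · exact le_mul_of_one_le_left' (by norm_num)

theorem norm_fderiv_sq_le_gradNormSq (u : E5 → E5) (x : E5) :
    ‖fderiv ℝ u x‖ ^ 2 ≤ gradNormSq u x := by
  have h0 : 0 ≤ gradNormSq u x := Finset.sum_nonneg fun _ _ => sq_nonneg _
  refine (Real.le_sqrt (norm_nonneg _) h0).1 ?_
  refine ContinuousLinearMap.opNorm_le_bound _ (Real.sqrt_nonneg _) fun v => ?_
  have hv : v = ∑ i, v i • eb i := by
    ext k
    simp [eb, Pi.single_apply]
  have hn : ‖v‖ = √(∑ i, |v i| ^ 2) := by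
    simp only [EuclideanSpace.norm_eq, Real.norm_eq_abs]
  calc ‖fderiv ℝ u x v‖ = ‖∑ i, v i • fderiv ℝ u x (eb i)‖ := by
        conv_lhs => rw [hv, map_sum]
        simp only [map_smul]
    _ ≤ ∑ i, ‖fderiv ℝ u x (eb i)‖ * |v i| := by
        refine (norm_sum_le _ _).trans_eq (Finset.sum_congr rfl fun i _ => ?_)
        rw [norm_smul, Real.norm_eq_abs, mul_comm]
    _ ≤ √(gradNormSq u x) * ‖v‖ := by
        rw [hn]
        exact Real.sum_mul_le_sqrt_mul_sqrt _ _ _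

theorem lintegral_sobolev_sq_le {u : E5 → E5} {ρ : ℝ} (hρ : 0 < ρ)
    (h2 : IntegrableOn (fun x => ‖u x‖ ^ 2) (ball (0 : E5) ρ))
    (hE : IntegrableOn (gradNormSq u) (ball (0 : E5) ρ)) :
    ∫⁻ x in ball (0 : E5) ρ, (‖u x‖ₑ / ENNReal.ofReal ρ + ‖fderiv ℝ u x‖ₑ) ^ (2 : ℝ) ≤
      ENNReal.ofReal (2 * ρ * (qA u 0 ρ + qE u 0 ρ)) := by
  have hg0 : ∀ x, 0 ≤ gradNormSq u x := fun x => Finset.sum_nonneg fun _ _ => sq_nonneg _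
  have heq : 2 * ρ * (qA u 0 ρ + qE u 0 ρ) =
      ∫ x in ball (0 : E5) ρ, (2 / ρ ^ 2 * ‖u x‖ ^ 2 + 2 * gradNormSq u x) := by
    rw [integral_add (h2.const_mul _) (hE.const_mul _), integral_const_mul, integral_const_mul,
      qA, qE]
    field_simp
  have hint : IntegrableOn (fun x => 2 / ρ ^ 2 * ‖u x‖ ^ 2 + 2 * gradNormSq u x)
      (ball (0 : E5) ρ) := (h2.const_mul _).add (hE.const_mul _)
  rw [heq, ofReal_integral_eq_lintegral_ofReal hint
    (Filter.Eventually.of_forall fun x => by have := hg0 x; positivity)]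
  refine lintegral_mono fun x => ?_
  rw [← ofReal_norm, ← ofReal_norm, ← ENNReal.ofReal_div_of_pos hρ,
    ← ENNReal.ofReal_add (by positivity) (norm_nonneg _),
    ENNReal.ofReal_rpow_of_nonneg (by positivity) (by norm_num)]
  refine ENNReal.ofReal_le_ofReal ?_
  have h := norm_fderiv_sq_le_gradNormSq u x
  have hs : 2 / ρ ^ 2 * ‖u x‖ ^ 2 = 2 * (‖u x‖ / ρ) ^ 2 := by
    rw [div_pow]; ring
  rw [Real.rpow_two, hs]
  nlinarith [sq_nonneg (‖u x‖ / ρ - ‖fderiv ℝ u x‖)]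

/-- Interpolation of `L³` between `L^q`, `L²` and `L^{10/3}`. -/
theorem lintegral_enorm_cube_le {α F : Type*} [MeasurableSpace α] [NormedAddCommGroup F]
    {μ : Measure α} {u : α → F} (hu : AEMeasurable (fun x => ‖u x‖ₑ) μ) {q s t β : ℝ}
    (hq : 0 ≤ q) (hs : 0 ≤ s) (hα : 0 ≤ t) (hβ : 0 ≤ β) (hsum : s + t + β = 1)
    (hexp : q * s + 2 * t + 10 / 3 * β = 3) :
    ∫⁻ x, ‖u x‖ₑ ^ (3 : ℝ) ∂μ ≤ (∫⁻ x, ‖u x‖ₑ ^ q ∂μ) ^ s * (∫⁻ x, ‖u x‖ₑ ^ (2 : ℝ) ∂μ) ^ t *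
      (∫⁻ x, ‖u x‖ₑ ^ ((10 : ℝ) / 3) ∂μ) ^ β := by
  have h := ENNReal.lintegral_prod_norm_pow_le (μ := μ) (Finset.univ : Finset (Fin 3))
    (f := ![fun x => ‖u x‖ₑ ^ q, fun x => ‖u x‖ₑ ^ (2 : ℝ), fun x => ‖u x‖ₑ ^ ((10 : ℝ) / 3)])
    (p := ![s, t, β])
    (fun i _ => by fin_cases i <;> exact hu.pow_const _)
    (by simpa [Fin.sum_univ_three] using hsum)
    (fun i _ => by fin_cases i <;> assumption)
  simp only [Fin.prod_univ_three] at h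
  refine le_trans (lintegral_mono fun x => ?_) h
  simp only [Matrix.cons_val_zero, Matrix.cons_val_one, Matrix.cons_val]
  rw [← ENNReal.rpow_mul, ← ENNReal.rpow_mul, ← ENNReal.rpow_mul,
    ← ENNReal.rpow_add_of_nonneg _ _ (by positivity) (by positivity),
    ← ENNReal.rpow_add_of_nonneg _ _ (by positivity) (by positivity), hexp]

theorem rpow_add_le_two_rpow_mul {x y p : ℝ} (hx : 0 ≤ x) (hy : 0 ≤ y) (hp : 0 ≤ p) :
    (x + y) ^ p ≤ 2 ^ p * (x ^ p + y ^ p) := by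
  have hx' := Real.rpow_nonneg hx p
  have hy' := Real.rpow_nonneg hy p
  have h2 : (0 : ℝ) ≤ 2 ^ p := by positivity
  rcases le_total x y with h | h
  · calc (x + y) ^ p ≤ (2 * y) ^ p := by gcongr; linarith
      _ = 2 ^ p * y ^ p := Real.mul_rpow zero_le_two hy
      _ ≤ _ := by gcongr; linarith
  · calc (x + y) ^ p ≤ (2 * x) ^ p := by gcongr; linarith
      _ = 2 ^ p * x ^ p := Real.mul_rpow zero_le_two hx
      _ ≤ _ := by gcongr; linarith

theorem scaled_interpolation_le {A C E k ρ q s α β ε γ : ℝ} (hA : 0 ≤ A) (hC : 0 ≤ C)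
    (hE : 0 ≤ E) (hk : 0 ≤ k) (hρ : 0 < ρ) (hα : 0 ≤ α) (hβ : 0 ≤ β) (hε : ε = 5 / 3 * β)
    (hγ : α + ε = γ) (hscale : (5 - q) * s + 3 * α + ε = 2) :
    (ρ ^ (5 - q) * C) ^ s * (ρ ^ 3 * A) ^ α *
        (k * (2 * ρ * (A + E)) ^ ((5 : ℝ) / 3)) ^ β ≤
      k ^ β * 2 ^ ε * 2 ^ ε * ρ ^ 2 * (A ^ α * C ^ s * E ^ ε + A ^ γ * C ^ s) := by
  have hε0 : 0 ≤ ε := by rw [hε]; positivity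
  have hAE : 0 ≤ A + E := add_nonneg hA hE
  have hρpow : ρ ^ ((5 - q) * s) * ρ ^ (3 * α) * ρ ^ ε = ρ ^ 2 := by
    rw [← Real.rpow_add hρ, ← Real.rpow_add hρ, hscale, Real.rpow_two]
  have h3 : (ρ ^ 3) ^ α = ρ ^ (3 * α) := by
    rw [← Real.rpow_natCast, ← Real.rpow_mul hρ.le]; norm_num
  have hAγ : A ^ α * A ^ ε = A ^ γ := by rw [← Real.rpow_add_of_nonneg hA hα hε0, hγ]
  have hCs := Real.rpow_nonneg hC s
  calc (ρ ^ (5 - q) * C) ^ s * (ρ ^ 3 * A) ^ α * (k * (2 * ρ * (A + E)) ^ ((5 : ℝ) / 3)) ^ β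
      = k ^ β * 2 ^ ε * (ρ ^ ((5 - q) * s) * ρ ^ (3 * α) * ρ ^ ε) * A ^ α * C ^ s *
          (A + E) ^ ε := by
        rw [Real.mul_rpow (by positivity) hC, Real.mul_rpow (by positivity) hA,
          Real.mul_rpow hk (by positivity), ← Real.rpow_mul hρ.le,
          ← Real.rpow_mul (x := 2 * ρ * (A + E)) (by positivity), ← hε,
          Real.mul_rpow (by positivity) hAE, Real.mul_rpow zero_le_two hρ.le, h3]
        ring
    _ ≤ k ^ β * 2 ^ ε * ρ ^ 2 * A ^ α * C ^ s * (2 ^ ε * (A ^ ε + E ^ ε)) := by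
        rw [hρpow]
        gcongr
        exact rpow_add_le_two_rpow_mul hA hE hε0
    _ = _ := by rw [← hAγ]; ring

/-- **Estimate (3.12).** For `u ∈ H¹(B_ρ; ℝ⁵)` and suitable `a ∈ (0,1)`,
`∫_{B_ρ}|u|³ ≤ N ρ² (A^{(q+3aq−10a)/(4q)} C^{a/q} E^{5(q−aq+2a)/(4q)} + A^{(3−a)/2} C^{a/q})`
with `N = N(a,q)`. -/
theorem cube_interpolation (q a : ℝ) (hq1 : 5 / 2 < q) (hq2 : q < 10 / 3)
    (ha1 : 0 < a) (ha2 : a < 1) (hqa : 0 < q + 3 * a * q - 10 * a) :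
    ∃ N > (0 : ℝ), ∀ ρ : ℝ, 0 < ρ → ∀ u : E5 → E5,
      (∀ x ∈ ball (0 : E5) ρ, DifferentiableAt ℝ u x) →
      IntegrableOn (fun x => ‖u x‖ ^ 2) (ball (0 : E5) ρ) →
      IntegrableOn (fun x => ‖u x‖ ^ q) (ball (0 : E5) ρ) →
      IntegrableOn (gradNormSq u) (ball (0 : E5) ρ) →
      (∫ x in ball (0 : E5) ρ, ‖u x‖ ^ 3) ≤
        N * ρ ^ 2 *
          (qA u 0 ρ ^ ((q + 3 * a * q - 10 * a) / (4 * q)) * qC u q 0 ρ ^ (a / q)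
              * qE u 0 ρ ^ (5 * (q - a * q + 2 * a) / (4 * q))
            + qA u 0 ρ ^ ((3 - a) / 2) * qC u q 0 ρ ^ (a / q)) := by
  obtain ⟨K, hK, hKu⟩ := exists_lintegral_ball_rpow_le
  have hq0 : 0 < q := by linarith
  set s := a / q with hs
  set α := (q + 3 * a * q - 10 * a) / (4 * q) with hα
  set ε := 5 * (q - a * q + 2 * a) / (4 * q) with hε
  set β := 3 * (q - a * q + 2 * a) / (4 * q) with hβ
  have hnum : 0 < q - a * q + 2 * a := by nlinarith
  have hs0 : 0 ≤ s := by positivity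
  have hα0 : 0 ≤ α := div_nonneg hqa.le (by positivity)
  have hβ0 : 0 ≤ β := by positivity
  have hεβ : ε = 5 / 3 * β := by rw [hε, hβ]; ring
  have hsum : s + α + β = 1 := by rw [hs, hα, hβ]; field_simp; ring
  have hexp : q * s + 2 * α + 10 / 3 * β = 3 := by rw [hs, hα, hβ]; field_simp; ring
  have hγ : α + ε = (3 - a) / 2 := by rw [hα, hε]; field_simp; ring
  have hscale : (5 - q) * s + 3 * α + ε = 2 := by rw [hs, hα, hε]; field_simp; ring
  have hk0 : 0 ≤ K.toReal := ENNReal.toReal_nonneg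
  refine ⟨K.toReal ^ β * 2 ^ ε * 2 ^ ε + 1, by positivity, fun ρ hρ u hu h2 hq hE => ?_⟩
  have hA0 : 0 ≤ qA u 0 ρ := by unfold qA; positivity
  have hC0 : 0 ≤ qC u q 0 ρ := by unfold qC; positivity
  have hE0 : 0 ≤ qE u 0 ρ := div_nonneg
    (integral_nonneg fun x => Finset.sum_nonneg fun _ _ => sq_nonneg _) hρ.le
  have hum : AEStronglyMeasurable u (volume.restrict (ball (0 : E5) ρ)) :=
    ContinuousOn.aestronglyMeasurable (fun x hx => (hu x hx).continuousAt.continuousWithinAt)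
      measurableSet_ball
  have hpow : ∀ (p : ℝ), 0 ≤ p → ∀ x, ‖u x‖ₑ ^ p = ENNReal.ofReal (‖u x‖ ^ p) := fun p hp x => by
    rw [← ofReal_norm, ENNReal.ofReal_rpow_of_nonneg (norm_nonneg _) hp]
  have hX2 : ∫⁻ x in ball (0 : E5) ρ, ‖u x‖ₑ ^ (2 : ℝ) =
      ENNReal.ofReal (ρ ^ 3 * qA u 0 ρ) := by
    rw [qA, mul_div_cancel₀ _ (by positivity), ofReal_integral_eq_lintegral_ofReal h2
      (Filter.Eventually.of_forall fun x => by positivity)]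
    simp only [hpow 2 zero_le_two, Real.rpow_two]
  have hXq : ∫⁻ x in ball (0 : E5) ρ, ‖u x‖ₑ ^ q =
      ENNReal.ofReal (ρ ^ (5 - q) * qC u q 0 ρ) := by
    rw [qC, mul_div_cancel₀ _ (by positivity), ofReal_integral_eq_lintegral_ofReal hq
      (Filter.Eventually.of_forall fun x => by positivity)]
    simp only [hpow q hq0.le]
  have hXs : ∫⁻ x in ball (0 : E5) ρ, ‖u x‖ₑ ^ ((10 : ℝ) / 3) ≤
      ENNReal.ofReal (K.toReal * (2 * ρ * (qA u 0 ρ + qE u 0 ρ)) ^ ((5 : ℝ) / 3)) := by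
    rw [ENNReal.ofReal_mul hk0, ENNReal.ofReal_toReal hK,
      ← ENNReal.ofReal_rpow_of_nonneg (by positivity) (by norm_num)]
    refine (hKu ρ u hρ hu).trans ?_
    gcongr
    exact lintegral_sobolev_sq_le hρ h2 hE
  rw [integral_eq_lintegral_of_nonneg_ae (Filter.Eventually.of_forall fun x => by positivity)
    (by fun_prop)]
  refine ENNReal.toReal_le_of_le_ofReal (by positivity) ?_
  have h3 : ∀ x, ENNReal.ofReal (‖u x‖ ^ 3) = ‖u x‖ₑ ^ (3 : ℝ) := fun x => by
    rw [hpow 3 (by norm_num)]; norm_cast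
  simp only [h3]
  refine (lintegral_enorm_cube_le hum.enorm hq0.le hs0 hα0 hβ0 hsum hexp).trans ?_
  rw [hX2, hXq]
  refine (mul_le_mul_right (ENNReal.rpow_le_rpow hXs hβ0) _).trans ?_
  rw [ENNReal.ofReal_rpow_of_nonneg (by positivity) hs0,
    ENNReal.ofReal_rpow_of_nonneg (by positivity) hα0,
    ENNReal.ofReal_rpow_of_nonneg (by positivity) hβ0, ← ENNReal.ofReal_mul (by positivity),
    ← ENNReal.ofReal_mul (by positivity)]
  refine ENNReal.ofReal_le_ofReal
    ((scaled_interpolation_le hA0 hC0 hE0 hk0 hρ hα0 hβ0 hεβ hγ hscale).trans ?_)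
  gcongr
  exact le_add_of_nonneg_right zero_le_one
end
end

section
/- Let c ∈ (0, 1/4), ρ > 0, and let u ∈ H^1(B_ρ; ℝ^5) where B_ρ ⊂ ℝ^5 is the ball of radius ρ centered at the origin. Then there is a constant N = N(c) > 0 such that ‖ |u| |∇u| ‖_{L^{1+c}(B_ρ)} ≤ N ( ‖u‖_{L²(B_ρ)}^{(1−4c)/(1+c)} ‖∇u‖_{L²(B_ρ)}^{(1+6c)/(1+c)} + ρ^{−5c/(1+c)} ‖u‖_{L²(B_ρ)} ‖∇u‖_{L²(B_ρ)} ). -/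
open MeasureTheory Metric Real NNReal

noncomputable section

open scoped ENNReal

lemma lintegral_rpow_le_measure_univ_rpow_mul {α : Type*} [MeasurableSpace α] (μ : Measure α)
    {q : ℝ} (hq : 1 < q) {f : α → ℝ≥0∞} (hf : AEMeasurable f μ) :
    (∫⁻ a, f a ∂μ) ^ q ≤ μ Set.univ ^ (q - 1) * ∫⁻ a, f a ^ q ∂μ := by
  have hpq := Real.HolderConjugate.conjExponent hq
  have hq0 : 0 < q := by linarith
  have h := ENNReal.lintegral_mul_le_Lp_mul_Lq μ hpq hf (aemeasurable_const (b := (1 : ℝ≥0∞)))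
  simp only [Pi.mul_apply, mul_one, ENNReal.one_rpow, lintegral_const, one_mul] at h
  calc (∫⁻ a, f a ∂μ) ^ q
      ≤ ((∫⁻ a, f a ^ q ∂μ) ^ (1 / q) * μ Set.univ ^ (1 / q.conjExponent)) ^ q := by gcongr
    _ = μ Set.univ ^ (q - 1) * ∫⁻ a, f a ^ q ∂μ := by
        rw [ENNReal.mul_rpow_of_nonneg _ _ hq0.le, ← ENNReal.rpow_mul, ← ENNReal.rpow_mul,
          one_div_mul_cancel hq0.ne', ENNReal.rpow_one, mul_comm]
        congr 2
        rw [Real.conjExponent]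
        field_simp

/-- A form of Minkowski's integral inequality: an `L^q` bound `φ s` on each slice `F s` gives the
`L^q` bound `∫ φ` on the integral of the slices. -/
lemma lintegral_lintegral_rpow_le {α β : Type*} [MeasurableSpace α] [MeasurableSpace β]
    {μ : Measure α} {m : Measure β} [SFinite μ] [SFinite m] {q : ℝ} (hq : 1 < q)
    {F : α → β → ℝ≥0∞} (hF : Measurable (Function.uncurry F)) {φ : β → ℝ≥0∞}
    (hφ : Measurable φ) (hφ0 : ∀ᵐ s ∂m, φ s ≠ 0) (hφt : ∀ᵐ s ∂m, φ s ≠ ∞)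
    (hle : ∀ᵐ s ∂m, ∫⁻ x, F x s ^ q ∂μ ≤ φ s ^ q) :
    ∫⁻ x, (∫⁻ s, F x s ∂m) ^ q ∂μ ≤ (∫⁻ s, φ s ∂m) ^ q := by
  have hq0 : 0 < q := by linarith
  set n := m.withDensity φ with hn
  have hF' : Measurable (Function.uncurry fun x s => F x s / φ s) := by
    have : Measurable (fun p : α × β => F p.1 p.2 / φ p.2) :=
      hF.div (hφ.comp measurable_snd)
    exact this
  have hFq : Measurable (Function.uncurry fun x s => (F x s / φ s) ^ q) := hF'.pow_const q
  have hFx : ∀ x, Measurable (fun s => F x s / φ s) := fun x => hF'.of_uncurry_left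
  have h1 : ∀ x, ∫⁻ s, F x s ∂m = ∫⁻ s, F x s / φ s ∂n := by
    intro x
    rw [hn, lintegral_withDensity_eq_lintegral_mul _ hφ (hFx x)]
    refine lintegral_congr_ae ?_
    filter_upwards [hφ0, hφt] with s h0 ht
    simp [ENNReal.mul_div_cancel h0 ht]
  have h2 : n Set.univ = ∫⁻ s, φ s ∂m := by
    rw [hn, withDensity_apply _ MeasurableSet.univ, Measure.restrict_univ]
  have h3 : ∫⁻ x, ∫⁻ s, (F x s / φ s) ^ q ∂n ∂μ ≤ n Set.univ := by
    rw [lintegral_lintegral_swap hFq.aemeasurable, h2, hn,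
      lintegral_withDensity_eq_lintegral_mul _ hφ hFq.lintegral_prod_left]
    refine lintegral_mono_ae ?_
    filter_upwards [hφ0, hφt, hle] with s h0 ht hs
    have : ∫⁻ x, (F x s / φ s) ^ q ∂μ ≤ 1 := by
      simp_rw [ENNReal.div_rpow_of_nonneg _ _ hq0.le, div_eq_mul_inv]
      rw [lintegral_mul_const _ (hF.of_uncurry_right.pow_const q), ← div_eq_mul_inv]
      exact ENNReal.div_le_of_le_mul (by simpa using hs)
    calc _ = φ s * ∫⁻ x, (F x s / φ s) ^ q ∂μ := rfl
      _ ≤ φ s * 1 := by gcongr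
      _ = φ s := mul_one _
  calc ∫⁻ x, (∫⁻ s, F x s ∂m) ^ q ∂μ
      ≤ ∫⁻ x, n Set.univ ^ (q - 1) * ∫⁻ s, (F x s / φ s) ^ q ∂n ∂μ := by
        refine lintegral_mono fun x => ?_
        rw [h1]
        exact lintegral_rpow_le_measure_univ_rpow_mul n hq (hFx x).aemeasurable
    _ = n Set.univ ^ (q - 1) * ∫⁻ x, ∫⁻ s, (F x s / φ s) ^ q ∂n ∂μ :=
        lintegral_const_mul _ hFq.lintegral_prod_right
    _ ≤ n Set.univ ^ (q - 1) * n Set.univ ^ (1 : ℝ) := by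
        rw [ENNReal.rpow_one]; gcongr
    _ = (∫⁻ s, φ s ∂m) ^ q := by
        rw [← ENNReal.rpow_add_of_nonneg _ _ (by linarith) zero_le_one, h2]; ring_nf

lemma lintegral_Ioc_ofReal_mul_rpow {θ t A : ℝ} (hθ : θ < 1) (ht : 0 < t) (hA : 0 ≤ A) :
    ∫⁻ s in Set.Ioc 0 t, ENNReal.ofReal (A * s ^ (-θ)) =
      ENNReal.ofReal (A * (t ^ (1 - θ) / (1 - θ))) := by
  have hint : IntervalIntegrable (fun s : ℝ => A * s ^ (-θ)) volume 0 t :=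
    (intervalIntegral.intervalIntegrable_rpow' (by linarith)).const_mul A
  rw [intervalIntegrable_iff_integrableOn_Ioc_of_le ht.le] at hint
  rw [← ofReal_integral_eq_lintegral_ofReal hint, ← intervalIntegral.integral_of_le ht.le,
    intervalIntegral.integral_const_mul, integral_rpow (Or.inl (by linarith))]
  · rw [Real.zero_rpow (by linarith), sub_zero]
    ring_nf
  · filter_upwards [ae_restrict_mem measurableSet_Ioc] with s hs
    have := hs.1
    positivity

lemma exists_scale_le {θ ρ a b : ℝ} (hθ : θ < 1) (hρ : 0 < ρ) (ha : 0 < a)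
    (hb : 0 < b) : ∃ t : ℝ, 0 < t ∧ t ≤ 1 / 2 ∧
      (t * ρ) ^ (-θ) * a + (t * ρ) ^ (1 - θ) * b ≤
        4 * (a ^ (1 - θ) * b ^ θ + ρ ^ (-θ) * a) := by
  have split : ∀ r : ℝ, 0 < r → r ^ (1 - θ) = r * r ^ (-θ) := fun r hr => by
    rw [sub_eq_add_neg, Real.rpow_add hr, Real.rpow_one]
  have hab : 0 < a ^ (1 - θ) * b ^ θ := by positivity
  have hρa : 0 < ρ ^ (-θ) * a := by positivity
  rcases le_total (b * ρ / 2) a with h | h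
  · refine ⟨1 / 2, by norm_num, le_rfl, ?_⟩
    have h2 : (1 / 2 * ρ) ^ (-θ) ≤ 2 * ρ ^ (-θ) := by
      rw [Real.mul_rpow (by norm_num) hρ.le, one_div, Real.inv_rpow zero_le_two,
        Real.rpow_neg zero_le_two, inv_inv]
      gcongr
      simpa using Real.rpow_le_rpow_of_exponent_le one_le_two hθ.le
    calc (1 / 2 * ρ) ^ (-θ) * a + (1 / 2 * ρ) ^ (1 - θ) * b
        = (1 / 2 * ρ) ^ (-θ) * (a + b * ρ / 2) := by
          rw [split _ (by positivity)]
          ring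
      _ ≤ (2 * ρ ^ (-θ)) * (2 * a) := by
          gcongr
          linarith
      _ ≤ _ := by linarith
  · refine ⟨a / (b * ρ), by positivity, ?_, ?_⟩
    · rw [div_le_iff₀ (by positivity)]
      linarith
    · have h1 : a / (b * ρ) * ρ = a / b := by field_simp
      have h2 : (a / b) ^ (-θ) * a = a ^ (1 - θ) * b ^ θ := by
        rw [Real.div_rpow ha.le hb.le, Real.rpow_neg hb.le, div_inv_eq_mul, split a ha]
        ring
      have h3 : (a / b) ^ (1 - θ) * b = (a / b) ^ (-θ) * a := by
        rw [split _ (by positivity)]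
        field_simp
      rw [h1, h3, h2]
      linarith

lemma enorm_le_enorm_add_lintegral_fderiv {E F : Type*} [NormedAddCommGroup E] [NormedSpace ℝ E]
    [NormedAddCommGroup F] [NormedSpace ℝ F] [CompleteSpace F] {u : E → F} {S : Set E} (hS : Convex ℝ S)
    (hu : ∀ x ∈ S, DifferentiableAt ℝ u x) {x y : E} (hx : x ∈ S) (hy : y ∈ S) {t : ℝ}
    (ht : 0 ≤ t) (ht1 : t ≤ 1) :
    ‖u x‖ₑ ≤ ‖u ((1 - t) • x + t • y)‖ₑ +
      ‖y - x‖ₑ * ∫⁻ s in Set.Ioc 0 t, ‖fderiv ℝ u ((1 - s) • x + s • y)‖ₑ := by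
  set γ : ℝ → E := fun s => (1 - s) • x + s • y with hγ
  have hγS : ∀ s ∈ Set.Icc 0 t, γ s ∈ S := fun s hs =>
    hS hx hy (by linarith [hs.2]) hs.1 (by ring)
  have hγd : ∀ s, HasDerivAt γ (y - x) s := by
    intro s
    have h1 : HasDerivAt (fun s : ℝ => (1 - s) • x) ((-1 : ℝ) • x) s :=
      ((hasDerivAt_id s).const_sub 1).smul_const x
    have h2 : HasDerivAt (fun s : ℝ => s • y) ((1 : ℝ) • y) s :=
      (hasDerivAt_id s).smul_const y
    have h3 : y - x = (-1 : ℝ) • x + (1 : ℝ) • y := by module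
    rw [h3]
    exact h1.add h2
  have hd : ∀ s ∈ Set.Icc 0 t, HasDerivAt (u ∘ γ) (fderiv ℝ u (γ s) (y - x)) s :=
    fun s hs => (hu _ (hγS s hs)).hasFDerivAt.comp_hasDerivAt s (hγd s)
  have hle : ∫⁻ s in Set.Ioc 0 t, ‖fderiv ℝ u (γ s) (y - x)‖ₑ ≤
      ‖y - x‖ₑ * ∫⁻ s in Set.Ioc 0 t, ‖fderiv ℝ u (γ s)‖ₑ := by
    rw [← lintegral_const_mul' _ _ enorm_ne_top]
    refine lintegral_mono fun s => ?_
    rw [mul_comm]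
    exact ContinuousLinearMap.le_opENorm _ _
  refine le_trans ?_ (add_le_add_right hle _)
  by_cases hfin : ∫⁻ s in Set.Ioc 0 t, ‖fderiv ℝ u (γ s) (y - x)‖ₑ = ∞
  · rw [hfin, add_top]; exact le_top
  have hmeas : AEStronglyMeasurable (fun s => fderiv ℝ u (γ s) (y - x))
      (volume.restrict (Set.Ioc 0 t)) := by
    refine (aestronglyMeasurable_deriv (u ∘ γ) _).congr ?_
    filter_upwards [ae_restrict_mem measurableSet_Ioc] with s hs
    exact (hd s ⟨hs.1.le, hs.2⟩).deriv
  have hint : IntervalIntegrable (fun s => fderiv ℝ u (γ s) (y - x)) volume 0 t := by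
    rw [intervalIntegrable_iff_integrableOn_Ioc_of_le ht]
    exact ⟨hmeas, lt_top_iff_ne_top.2 hfin⟩
  have hftc := intervalIntegral.integral_eq_sub_of_hasDerivAt (f := u ∘ γ)
    (by rwa [Set.uIcc_of_le ht]) hint
  have hux : u x = u (γ t) - ∫ s in Set.Ioc 0 t, fderiv ℝ u (γ s) (y - x) := by
    rw [← intervalIntegral.integral_of_le ht, hftc]
    simp [hγ]
  calc ‖u x‖ₑ = ‖u (γ t) - ∫ s in Set.Ioc 0 t, fderiv ℝ u (γ s) (y - x)‖ₑ := by rw [← hux]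
    _ ≤ ‖u (γ t)‖ₑ + ‖∫ s in Set.Ioc 0 t, fderiv ℝ u (γ s) (y - x)‖ₑ := enorm_sub_le
    _ ≤ _ := by gcongr; exact enorm_integral_le_lintegral_enorm _

section
variable {E : Type*} [NormedAddCommGroup E] [NormedSpace ℝ E] [MeasurableSpace E] [BorelSpace E]

/-- The mean with respect to `ν` of `h` over the contraction of ratio `s` towards `x`. -/
def contractMean (ν : Measure E) (h : E → ℝ≥0∞) (s : ℝ) (x : E) : ℝ≥0∞ :=
  ∫⁻ y, h ((1 - s) • x + s • y) ∂ν

lemma measurable_contractMean [SecondCountableTopology E] (ν : Measure E) [SFinite ν]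
    {h : E → ℝ≥0∞} (hh : Measurable h) :
    Measurable (Function.uncurry fun x s => contractMean ν h s x) := by
  have : Measurable fun p : (E × ℝ) × E => h ((1 - p.1.2) • p.1.1 + p.1.2 • p.2) :=
    hh.comp (by fun_prop)
  exact this.lintegral_prod_right'

lemma measurable_indicator_enorm_of_differentiableAt {F : Type*} [NormedAddCommGroup F]
    [NormedSpace ℝ F] {u : E → F} {S : Set E} (hS : MeasurableSet S)
    (hu : ∀ x ∈ S, DifferentiableAt ℝ u x) : Measurable (S.indicator fun x => ‖u x‖ₑ) := by
  classical
  rw [← Set.piecewise_eq_indicator]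
  refine ContinuousOn.measurable_piecewise ?_ continuousOn_const hS
  exact ContinuousOn.enorm fun x hx => (hu x hx).continuousAt.continuousWithinAt

lemma measurable_indicator_enorm_fderiv {F : Type*} [NormedAddCommGroup F]
    [NormedSpace ℝ F] [CompleteSpace F] (u : E → F) {S : Set E} (hS : MeasurableSet S) :
    Measurable (S.indicator fun x => ‖fderiv ℝ u x‖ₑ) :=
  (continuous_enorm.measurable.comp (measurable_fderiv ℝ u)).indicator hS

end

section
variable {E : Type*} [NormedAddCommGroup E] [NormedSpace ℝ E] [FiniteDimensional ℝ E]
  [MeasurableSpace E] [BorelSpace E] (μ : Measure E) [μ.IsAddHaarMeasure]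

open Module

lemma lintegral_comp_add_smul {f : E → ℝ≥0∞} (hf : Measurable f) (v : E) {s : ℝ} (hs : 0 < s) :
    ∫⁻ y, f (v + s • y) ∂μ = ENNReal.ofReal ((s ^ finrank ℝ E)⁻¹) * ∫⁻ y, f y ∂μ := by
  have h := Measure.map_addHaar_smul μ hs.ne'
  have hm : Measurable fun y : E => s • y := measurable_const_smul s
  rw [← lintegral_add_left_eq_self f v, ← lintegral_map (f := fun y => f (v + y)) (by fun_prop) hm,
    h, lintegral_smul_measure, abs_of_pos (by positivity), smul_eq_mul]

lemma lintegral_contractMean_rpow_le (ν : Measure E) [IsProbabilityMeasure ν] {K : ℝ≥0∞}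
    (hν : ν ≤ K • μ) {h : E → ℝ≥0∞} (hh : Measurable h) {q s : ℝ} (hq : 2 ≤ q) (hs : 0 < s)
    (hs2 : s ≤ 1 / 2) :
    ∫⁻ x, contractMean ν h s x ^ q ∂μ ≤
      (K * (ENNReal.ofReal ((s ^ finrank ℝ E)⁻¹) * ∫⁻ y, h y ^ (2 : ℝ) ∂μ)) ^ (q / 2 - 1) *
        (ENNReal.ofReal (2 ^ finrank ℝ E) * ∫⁻ y, h y ^ (2 : ℝ) ∂μ) := by
  have hE := FiniteDimensional.proper_real E
  have hh2 : Measurable fun y => h y ^ (2 : ℝ) := hh.pow_const _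
  set P : E → ℝ≥0∞ := contractMean ν (fun y => h y ^ (2 : ℝ)) s with hP
  set C := K * (ENNReal.ofReal ((s ^ finrank ℝ E)⁻¹) * ∫⁻ y, h y ^ (2 : ℝ) ∂μ) with hC
  have hPm : Measurable P :=
    (measurable_contractMean ν hh2).of_uncurry_right (y := s)
  have h1 : ∀ x, contractMean ν h s x ^ (2 : ℝ) ≤ P x := by
    intro x
    have := lintegral_rpow_le_measure_univ_rpow_mul ν (q := 2) one_lt_two
      (f := fun y => h ((1 - s) • x + s • y)) (hh.comp (by fun_prop)).aemeasurable
    simp only [measure_univ, ENNReal.one_rpow, one_mul] at this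
    exact this
  have h2 : ∀ x, P x ≤ C := by
    intro x
    calc P x ≤ ∫⁻ y, h ((1 - s) • x + s • y) ^ (2 : ℝ) ∂(K • μ) := lintegral_mono' hν le_rfl
      _ = C := by
        rw [lintegral_smul_measure, lintegral_comp_add_smul μ hh2 _ hs, smul_eq_mul]
  have h3 : ∫⁻ x, P x ∂μ ≤ ENNReal.ofReal (2 ^ finrank ℝ E) * ∫⁻ y, h y ^ (2 : ℝ) ∂μ := by
    have hm : Measurable (Function.uncurry fun x y => h ((1 - s) • x + s • y) ^ (2 : ℝ)) :=
      hh2.comp (f := fun p : E × E => (1 - s) • p.1 + s • p.2) (by fun_prop)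
    rw [hP]
    unfold contractMean
    rw [lintegral_lintegral_swap hm.aemeasurable]
    have h4 : ∀ y, ∫⁻ x, h ((1 - s) • x + s • y) ^ (2 : ℝ) ∂μ =
        ENNReal.ofReal (((1 - s) ^ finrank ℝ E)⁻¹) * ∫⁻ y, h y ^ (2 : ℝ) ∂μ := by
      intro y
      rw [← lintegral_comp_add_smul μ hh2 (s • y) (by linarith : 0 < 1 - s)]
      simp_rw [add_comm]
    simp_rw [h4]
    rw [lintegral_const, measure_univ, mul_one]
    gcongr
    rw [← inv_pow]
    refine pow_le_pow_left₀ (inv_nonneg.2 (by linarith)) ?_ _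
    rw [inv_le_comm₀ (by linarith) (by norm_num)]
    linarith
  calc ∫⁻ x, contractMean ν h s x ^ q ∂μ
      ≤ ∫⁻ x, C ^ (q / 2 - 1) * P x ∂μ := by
        refine lintegral_mono fun x => ?_
        calc contractMean ν h s x ^ q = (contractMean ν h s x ^ (2 : ℝ)) ^ (q / 2) := by
              rw [← ENNReal.rpow_mul]; ring_nf
          _ ≤ P x ^ (q / 2) := by gcongr; exact h1 x
          _ = P x ^ (q / 2 - 1) * P x := by
              conv_rhs => rw [← ENNReal.rpow_one (P x), ← ENNReal.rpow_mul,
                ← ENNReal.rpow_add_of_nonneg _ _ (by linarith) zero_le_one]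
              ring_nf
          _ ≤ C ^ (q / 2 - 1) * P x := by
              gcongr
              · linarith
              · exact h2 x
    _ = C ^ (q / 2 - 1) * ∫⁻ x, P x ∂μ := lintegral_const_mul _ hPm
    _ ≤ _ := by gcongr

lemma enorm_le_contractMean_add {F : Type*} [NormedAddCommGroup F] [NormedSpace ℝ F]
    [CompleteSpace F] {u : E → F} {ρ : ℝ} (hρ : 0 < ρ)
    (hu : ∀ x ∈ ball (0 : E) ρ, DifferentiableAt ℝ u x) (ν : Measure E) [IsProbabilityMeasure ν]
    (hν : ∀ᵐ y ∂ν, y ∈ ball (0 : E) ρ) {x : E} (hx : x ∈ ball (0 : E) ρ) {t : ℝ} (ht : 0 ≤ t)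
    (ht1 : t ≤ 1) :
    ‖u x‖ₑ ≤ contractMean ν ((ball (0 : E) ρ).indicator fun x => ‖u x‖ₑ) t x +
      ENNReal.ofReal (2 * ρ) * ∫⁻ s in Set.Ioc 0 t,
        contractMean ν ((ball (0 : E) ρ).indicator fun x => ‖fderiv ℝ u x‖ₑ) s x := by
  have hE := FiniteDimensional.proper_real E
  set B := ball (0 : E) ρ with hB
  set f := B.indicator fun x => ‖u x‖ₑ with hf
  set g := B.indicator fun x => ‖fderiv ℝ u x‖ₑ with hg
  have hfm : Measurable f := measurable_indicator_enorm_of_differentiableAt measurableSet_ball hu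
  have hgm : Measurable g := measurable_indicator_enorm_fderiv u measurableSet_ball
  have hconv : Convex ℝ B := convex_ball _ _
  have hmem : ∀ y ∈ B, ∀ s, 0 ≤ s → s ≤ t → (1 - s) • x + s • y ∈ B := fun y hy s h0 h1 =>
    hconv hx hy (by linarith) h0 (by ring)
  have key : ∀ y ∈ B, ‖u x‖ₑ ≤ f ((1 - t) • x + t • y) +
      ENNReal.ofReal (2 * ρ) * ∫⁻ s in Set.Ioc 0 t, g ((1 - s) • x + s • y) := by
    intro y hy
    have h := enorm_le_enorm_add_lintegral_fderiv hconv hu hx hy ht ht1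
    have h1 : f ((1 - t) • x + t • y) = ‖u ((1 - t) • x + t • y)‖ₑ :=
      Set.indicator_of_mem (hmem y hy t ht le_rfl) _
    have h2 : ∫⁻ s in Set.Ioc 0 t, g ((1 - s) • x + s • y) =
        ∫⁻ s in Set.Ioc 0 t, ‖fderiv ℝ u ((1 - s) • x + s • y)‖ₑ :=
      setLIntegral_congr_fun measurableSet_Ioc fun s hs =>
        Set.indicator_of_mem (hmem y hy s hs.1.le hs.2) _
    have h3 : ‖y - x‖ₑ ≤ ENNReal.ofReal (2 * ρ) := by
      rw [← ofReal_norm]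
      apply ENNReal.ofReal_le_ofReal
      have := norm_sub_le y x
      rw [hB, mem_ball_zero_iff] at hx hy
      linarith
    rw [h1, h2]
    refine h.trans ?_
    gcongr
  have hm2 : Measurable (Function.uncurry fun (y : E) (s : ℝ) => g ((1 - s) • x + s • y)) :=
    hgm.comp (f := fun p : E × ℝ => (1 - p.2) • x + p.2 • p.1) (by fun_prop)
  calc ‖u x‖ₑ = ∫⁻ _, ‖u x‖ₑ ∂ν := by simp
    _ ≤ ∫⁻ y, (f ((1 - t) • x + t • y) +
          ENNReal.ofReal (2 * ρ) * ∫⁻ s in Set.Ioc 0 t, g ((1 - s) • x + s • y)) ∂ν :=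
        lintegral_mono_ae (hν.mono key)
    _ = contractMean ν f t x + ENNReal.ofReal (2 * ρ) *
          ∫⁻ y, (∫⁻ s in Set.Ioc 0 t, g ((1 - s) • x + s • y)) ∂ν := by
        have hfx : Measurable fun y => f ((1 - t) • x + t • y) := hfm.comp (by fun_prop)
        rw [lintegral_add_left hfx, lintegral_const_mul _ hm2.lintegral_prod_right]
        rfl
    _ = _ := by
        rw [lintegral_lintegral_swap hm2.aemeasurable]
        rfl

/-- `L^q` bound on contraction means for the normalized Haar measure of a ball. -/
lemma lintegral_contractMean_rpow_le_ball {q : ℝ} (hq : 2 ≤ q) :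
    ∃ C > (0 : ℝ), ∀ ρ : ℝ, 0 < ρ → ∀ h : E → ℝ≥0∞, Measurable h → ∀ b : ℝ, 0 < b →
      ∫⁻ y, h y ^ (2 : ℝ) ∂μ ≤ ENNReal.ofReal (b ^ 2) → ∀ s : ℝ, 0 < s → s ≤ 1 / 2 →
      ∫⁻ x, contractMean ((μ (ball 0 ρ))⁻¹ • μ.restrict (ball 0 ρ)) h s x ^ q ∂μ ≤
        ENNReal.ofReal (C * (s * ρ) ^ (-(finrank ℝ E * (1 / 2 - 1 / q))) * b) ^ q := by
  have hq0 : 0 < q := by linarith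
  set d := finrank ℝ E with hd
  set V := μ.real (ball (0 : E) 1) with hV
  have hV0 : 0 < V := 
    ENNReal.toReal_pos (measure_ball_pos μ _ one_pos).ne' measure_ball_lt_top.ne
  refine ⟨(V⁻¹ ^ (q / 2 - 1) * 2 ^ d) ^ (1 / q), by positivity, ?_⟩
  intro ρ hρ h hh b hb hI s hs hs2
  set ν := (μ (ball (0 : E) ρ))⁻¹ • μ.restrict (ball 0 ρ) with hν
  have hB0 : μ (ball (0 : E) ρ) ≠ 0 := (measure_ball_pos μ _ hρ).ne'
  have hBt : μ (ball (0 : E) ρ) ≠ ∞ := measure_ball_lt_top.ne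
  have hνp : IsProbabilityMeasure ν := ⟨by simp [hν, ENNReal.inv_mul_cancel hB0 hBt]⟩
  have hνle : ν ≤ (μ (ball (0 : E) ρ))⁻¹ • μ := by
    rw [hν]
    gcongr
    exact Measure.restrict_le_self
  have hBr : (μ (ball (0 : E) ρ))⁻¹ = ENNReal.ofReal ((ρ ^ d * V)⁻¹) := by
    rw [Measure.addHaar_ball_of_pos μ _ hρ, ENNReal.ofReal_inv_of_pos (by positivity),
      ENNReal.ofReal_mul (by positivity), hV, ofReal_measureReal]
  refine (lintegral_contractMean_rpow_le μ ν hνle hh hq hs hs2).trans ?_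
  calc _ ≤ (ENNReal.ofReal ((ρ ^ d * V)⁻¹) * (ENNReal.ofReal ((s ^ d)⁻¹) *
          ENNReal.ofReal (b ^ 2))) ^ (q / 2 - 1) *
        (ENNReal.ofReal (2 ^ d) * ENNReal.ofReal (b ^ 2)) := by
        rw [hBr]
        gcongr
        linarith
    _ = ENNReal.ofReal (((ρ ^ d * V)⁻¹ * ((s ^ d)⁻¹ * b ^ 2)) ^ (q / 2 - 1) *
          (2 ^ d * b ^ 2)) := by
        rw [← ENNReal.ofReal_mul (by positivity), ← ENNReal.ofReal_mul (by positivity),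
          ← ENNReal.ofReal_mul (by positivity),
          ENNReal.ofReal_rpow_of_nonneg (by positivity) (by linarith),
          ← ENNReal.ofReal_mul (by positivity)]
    _ = _ := by
        rw [ENNReal.ofReal_rpow_of_nonneg (by positivity) hq0.le]
        congr 1
        have e1 : (ρ ^ d * V)⁻¹ * ((s ^ d)⁻¹ * b ^ 2) = V⁻¹ * (((s * ρ) ^ d)⁻¹ * b ^ 2) := by
          rw [mul_pow]
          field_simp
        have e2 : (((s * ρ) ^ d)⁻¹) ^ (q / 2 - 1) = ((s * ρ) ^ (-(d * (1 / 2 - 1 / q)))) ^ q := by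
          rw [← Real.rpow_natCast, ← Real.rpow_neg (by positivity), ← Real.rpow_mul (by positivity),
            ← Real.rpow_mul (by positivity)]
          congr 1
          field_simp
        have e3 : b ^ q = (b ^ 2) ^ (q / 2 - 1) * b ^ 2 := by
          rw [← Real.rpow_natCast, ← Real.rpow_mul hb.le, ← Real.rpow_add hb]
          congr 1
          push_cast
          ring
        have e4 : ((V⁻¹ ^ (q / 2 - 1) * 2 ^ d) ^ (1 / q)) ^ q = V⁻¹ ^ (q / 2 - 1) * 2 ^ d := by
          rw [← Real.rpow_mul (by positivity), one_div_mul_cancel hq0.ne', Real.rpow_one]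
        rw [e1, Real.mul_rpow (by positivity) (by positivity),
          Real.mul_rpow (by positivity) (by positivity), e2,
          Real.mul_rpow (z := q) (by positivity) hb.le,
          Real.mul_rpow (z := q) (by positivity) (by positivity), e4, e3]
        ring

/-- Local Gagliardo–Nirenberg inequality on a ball at a subcritical exponent, before optimizing
the scale `t * ρ`. -/
lemma lintegral_rpow_le_of_differentiableAt_ball {F : Type*} [NormedAddCommGroup F]
    [NormedSpace ℝ F] [CompleteSpace F] {q : ℝ} (hq : 2 ≤ q)
    (hθ : finrank ℝ E * (1 / 2 - 1 / q) < 1) :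
    ∃ K > (0 : ℝ), ∀ ρ : ℝ, 0 < ρ → ∀ u : E → F, (∀ x ∈ ball (0 : E) ρ, DifferentiableAt ℝ u x) →
      ∀ a : ℝ, 0 < a → ∫⁻ x in ball (0 : E) ρ, ‖u x‖ₑ ^ (2 : ℝ) ∂μ ≤ ENNReal.ofReal (a ^ 2) →
      ∀ b : ℝ, 0 < b →
        ∫⁻ x in ball (0 : E) ρ, ‖fderiv ℝ u x‖ₑ ^ (2 : ℝ) ∂μ ≤ ENNReal.ofReal (b ^ 2) →
      ∀ t : ℝ, 0 < t → t ≤ 1 / 2 →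
      (∫⁻ x in ball (0 : E) ρ, ‖u x‖ₑ ^ q ∂μ) ^ (1 / q) ≤
        ENNReal.ofReal (K * ((t * ρ) ^ (-(finrank ℝ E * (1 / 2 - 1 / q))) * a +
          (t * ρ) ^ (1 - finrank ℝ E * (1 / 2 - 1 / q)) * b)) := by
  have hq0 : 0 < q := by linarith
  obtain ⟨C, hC, hmean⟩ := lintegral_contractMean_rpow_le_ball μ hq
  set θ := finrank ℝ E * (1 / 2 - 1 / q) with hθd
  have hθ0 : 0 ≤ θ := by
    have : 1 / q ≤ 1 / 2 := one_div_le_one_div_of_le two_pos hq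
    have : 0 ≤ 1 / 2 - 1 / q := by linarith
    positivity
  have h1θ : 0 < 1 - θ := by linarith
  refine ⟨2 * C / (1 - θ), by positivity, ?_⟩
  intro ρ hρ u hu a ha hua b hb hub t ht ht2
  set B := ball (0 : E) ρ with hB
  set ν := (μ B)⁻¹ • μ.restrict B with hν
  have hB0 : μ B ≠ 0 := (measure_ball_pos μ _ hρ).ne'
  have hBt : μ B ≠ ∞ := measure_ball_lt_top.ne
  have hνp : IsProbabilityMeasure ν := ⟨by simp [hν, ENNReal.inv_mul_cancel hB0 hBt]⟩
  have hνB : ∀ᵐ y ∂ν, y ∈ B := Measure.ae_smul_measure (ae_restrict_mem measurableSet_ball) _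
  have hE := FiniteDimensional.proper_real E
  set f := B.indicator fun x => ‖u x‖ₑ with hf
  set g := B.indicator fun x => ‖fderiv ℝ u x‖ₑ with hg
  have hfm : Measurable f := measurable_indicator_enorm_of_differentiableAt measurableSet_ball hu
  have hgm : Measurable g := measurable_indicator_enorm_fderiv u measurableSet_ball
  have hind : ∀ w : E → ℝ≥0∞, ∫⁻ x, (B.indicator w x) ^ (2 : ℝ) ∂μ =
      ∫⁻ x in B, w x ^ (2 : ℝ) ∂μ := by
    intro w
    rw [hB, ← lintegral_indicator measurableSet_ball, ← hB]
    congr 1 with x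
    by_cases hx : x ∈ B <;> simp [hx]
  have hcf := hmean ρ hρ f hfm a ha ((hind _).trans_le hua) t ht ht2
  have hcg := hmean ρ hρ g hgm b hb ((hind _).trans_le hub)
  have hmf : Measurable (contractMean ν f t) := (measurable_contractMean ν hfm).of_uncurry_right
  have hmg := measurable_contractMean ν hgm
  set G : E → ℝ≥0∞ := fun x => ∫⁻ s in Set.Ioc 0 t, contractMean ν g s x with hG
  have hmG : Measurable G := hmg.lintegral_prod_right
  have hGq : ∫⁻ x, G x ^ q ∂μ ≤
      ENNReal.ofReal (C * ρ ^ (-θ) * b * (t ^ (1 - θ) / (1 - θ))) ^ q := by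
    rw [← lintegral_Ioc_ofReal_mul_rpow hθ ht (by positivity)]
    have hpos : ∀ s ∈ Set.Ioc 0 t, 0 < C * ρ ^ (-θ) * b * s ^ (-θ) := fun s hs => by
      have := hs.1
      positivity
    refine lintegral_lintegral_rpow_le (by linarith) hmg (by fun_prop) ?_ ?_ ?_
    · filter_upwards [ae_restrict_mem measurableSet_Ioc] with s hs
      simpa using hpos s hs
    · exact .of_forall fun _ => ENNReal.ofReal_ne_top
    · filter_upwards [ae_restrict_mem measurableSet_Ioc] with s hs
      refine (hcg s hs.1 (hs.2.trans ht2)).trans_eq ?_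
      rw [Real.mul_rpow hs.1.le hρ.le]
      ring_nf
  have hroot : ∀ {w : ℝ≥0∞} {r : ℝ}, w ≤ ENNReal.ofReal r ^ q → w ^ (1 / q) ≤ ENNReal.ofReal r := by
    intro w r hw
    rwa [one_div, ENNReal.rpow_inv_le_iff hq0]
  calc (∫⁻ x in B, ‖u x‖ₑ ^ q ∂μ) ^ (1 / q)
      ≤ (∫⁻ x, (contractMean ν f t + fun x => ENNReal.ofReal (2 * ρ) * G x) x ^ q ∂μ) ^ (1 / q) := by
        refine ENNReal.rpow_le_rpow ?_ (by positivity)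
        refine le_trans (setLIntegral_mono' measurableSet_ball fun x hx => ?_)
          (setLIntegral_le_lintegral _ _)
        gcongr
        exact enorm_le_contractMean_add hρ hu ν hνB hx ht.le (by linarith)
    _ ≤ (∫⁻ x, contractMean ν f t x ^ q ∂μ) ^ (1 / q) +
          (∫⁻ x, (ENNReal.ofReal (2 * ρ) * G x) ^ q ∂μ) ^ (1 / q) :=
        ENNReal.lintegral_Lp_add_le hmf.aemeasurable (hmG.const_mul _).aemeasurable (by linarith)
    _ = (∫⁻ x, contractMean ν f t x ^ q ∂μ) ^ (1 / q) +
          ENNReal.ofReal (2 * ρ) * (∫⁻ x, G x ^ q ∂μ) ^ (1 / q) := by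
        simp_rw [ENNReal.mul_rpow_of_nonneg _ _ hq0.le]
        rw [lintegral_const_mul _ (hmG.pow_const q),
          ENNReal.mul_rpow_of_nonneg _ _ (by positivity), ← ENNReal.rpow_mul,
          mul_one_div_cancel hq0.ne', ENNReal.rpow_one]
    _ ≤ ENNReal.ofReal (C * (t * ρ) ^ (-θ) * a) + ENNReal.ofReal (2 * ρ) *
          ENNReal.ofReal (C * ρ ^ (-θ) * b * (t ^ (1 - θ) / (1 - θ))) := by
        gcongr
        · exact hroot hcf
        · exact hroot hGq
    _ = ENNReal.ofReal (C * ((t * ρ) ^ (-θ) * a) +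
          2 * C / (1 - θ) * ((t * ρ) ^ (1 - θ) * b)) := by
        rw [← ENNReal.ofReal_mul (by positivity), ← ENNReal.ofReal_add (by positivity)
          (by positivity), Real.mul_rpow ht.le hρ.le (z := 1 - θ),
          show 1 - θ = 1 + -θ by ring, Real.rpow_add hρ, Real.rpow_one]
        ring_nf
    _ ≤ _ := by
        apply ENNReal.ofReal_le_ofReal
        rw [mul_add]
        gcongr
        rw [le_div_iff₀ h1θ]
        nlinarith

/-- Local Gagliardo–Nirenberg inequality on a ball at a subcritical exponent. -/
lemma lintegral_rpow_le_interpolation_ball {F : Type*} [NormedAddCommGroup F]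
    [NormedSpace ℝ F] [CompleteSpace F] {q : ℝ} (hq : 2 ≤ q)
    (hθ : finrank ℝ E * (1 / 2 - 1 / q) < 1) :
    ∃ K > (0 : ℝ), ∀ ρ : ℝ, 0 < ρ → ∀ u : E → F, (∀ x ∈ ball (0 : E) ρ, DifferentiableAt ℝ u x) →
      ∀ a : ℝ, 0 < a → ∫⁻ x in ball (0 : E) ρ, ‖u x‖ₑ ^ (2 : ℝ) ∂μ ≤ ENNReal.ofReal (a ^ 2) →
      ∀ b : ℝ, 0 < b →
        ∫⁻ x in ball (0 : E) ρ, ‖fderiv ℝ u x‖ₑ ^ (2 : ℝ) ∂μ ≤ ENNReal.ofReal (b ^ 2) →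
      (∫⁻ x in ball (0 : E) ρ, ‖u x‖ₑ ^ q ∂μ) ^ (1 / q) ≤
        ENNReal.ofReal (K * (a ^ (1 - finrank ℝ E * (1 / 2 - 1 / q)) *
          b ^ (finrank ℝ E * (1 / 2 - 1 / q)) +
            ρ ^ (-(finrank ℝ E * (1 / 2 - 1 / q))) * a)) := by
  obtain ⟨K, hK, h⟩ := lintegral_rpow_le_of_differentiableAt_ball (F := F) μ hq hθ
  refine ⟨K * 4, by positivity, fun ρ hρ u hu a ha hua b hb hub => ?_⟩
  obtain ⟨t, ht, ht2, hle⟩ := exists_scale_le hθ hρ ha hb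
  refine (h ρ hρ u hu a ha hua b hb hub t ht ht2).trans (ENNReal.ofReal_le_ofReal ?_)
  rw [mul_assoc K 4]
  gcongr

end

lemma gradNormSq_nonneg (u : E5 → E5) (x : E5) : 0 ≤ gradNormSq u x :=
  Finset.sum_nonneg fun _ _ => by positivity

lemma measurable_gradNormSq (u : E5 → E5) : Measurable (gradNormSq u) := by
  unfold gradNormSq
  exact Finset.measurable_sum _ fun i _ =>
    ((measurable_fderiv_apply_const ℝ u (eb i)).norm).pow_const 2

lemma norm_fderiv_le_sqrt_gradNormSq (u : E5 → E5) (x : E5) :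
    ‖fderiv ℝ u x‖ ≤ √(gradNormSq u x) := by
  refine ContinuousLinearMap.opNorm_le_bound _ (Real.sqrt_nonneg _) fun v => ?_
  have hv : v = ∑ i, v i • eb i := by
    ext j
    simp [eb, Finset.sum_apply, Pi.single_apply]
  calc ‖fderiv ℝ u x v‖ = ‖∑ i, v i • fderiv ℝ u x (eb i)‖ := by
        conv_lhs => rw [hv]
        simp only [map_sum, map_smul]
    _ ≤ ∑ i, ‖fderiv ℝ u x (eb i)‖ * ‖v i‖ := by
        refine norm_sum_le_of_le _ fun i _ => ?_
        rw [norm_smul, mul_comm]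
    _ ≤ √(∑ i, ‖fderiv ℝ u x (eb i)‖ ^ 2) * √(∑ i, ‖v i‖ ^ 2) :=
        Real.sum_mul_le_sqrt_mul_sqrt _ _ _
    _ = √(gradNormSq u x) * ‖v‖ := by rw [EuclideanSpace.norm_eq]; rfl

/-- Hölder's inequality for the convection term. -/
lemma lintegral_convection_rpow_le {α : Type*} [MeasurableSpace α] {μ : Measure α} {c : ℝ}
    (hc0 : 0 ≤ c) (hc1 : c < 1) {f g : α → ℝ≥0∞} (hf : AEMeasurable f μ) (hg : AEMeasurable g μ) :
    (∫⁻ x, (f x * g x) ^ (1 + c) ∂μ) ^ (1 / (1 + c)) ≤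
      (∫⁻ x, f x ^ (2 * (1 + c) / (1 - c)) ∂μ) ^ (1 / (2 * (1 + c) / (1 - c))) *
        (∫⁻ x, g x ^ (2 : ℝ) ∂μ) ^ (1 / 2 : ℝ) := by
  have h1 : 0 < 1 + c := by linarith
  have h2 : 0 < 1 - c := by linarith
  refine ENNReal.lintegral_Lp_mul_le_Lq_mul_Lr h1 ?_ ?_ μ hf hg
  · rw [lt_div_iff₀ h2]
    nlinarith
  · field_simp
    ring

/-- **Estimate (3.15).** For `u ∈ H¹(B_ρ; ℝ⁵)` and `c ∈ (0,1/4)`,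
`‖|u||∇u|‖_{L^{1+c}(B_ρ)} ≤ N (‖u‖_{L²}^{(1−4c)/(1+c)} ‖∇u‖_{L²}^{(1+6c)/(1+c)}
+ ρ^{−5c/(1+c)} ‖u‖_{L²} ‖∇u‖_{L²})` with `N = N(c)`. -/
theorem convection_interpolation (c : ℝ) (hc1 : 0 < c) (hc2 : c < 1 / 4) :
    ∃ N > (0 : ℝ), ∀ ρ : ℝ, 0 < ρ → ∀ u : E5 → E5,
      (∀ x ∈ ball (0 : E5) ρ, DifferentiableAt ℝ u x) →
      IntegrableOn (fun x => ‖u x‖ ^ 2) (ball (0 : E5) ρ) →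
      IntegrableOn (gradNormSq u) (ball (0 : E5) ρ) →
      (∫ x in ball (0 : E5) ρ, (‖u x‖ * Real.sqrt (gradNormSq u x)) ^ (1 + c))
          ^ (1 / (1 + c)) ≤
        N * (((∫ x in ball (0 : E5) ρ, ‖u x‖ ^ 2) ^ ((1 : ℝ) / 2)) ^ ((1 - 4 * c) / (1 + c))
              * ((∫ x in ball (0 : E5) ρ, gradNormSq u x) ^ ((1 : ℝ) / 2))
                  ^ ((1 + 6 * c) / (1 + c))
            + ρ ^ (-(5 * c) / (1 + c))
              * (∫ x in ball (0 : E5) ρ, ‖u x‖ ^ 2) ^ ((1 : ℝ) / 2)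
              * (∫ x in ball (0 : E5) ρ, gradNormSq u x) ^ ((1 : ℝ) / 2)) := by
  have h1c : 0 < 1 + c := by linarith
  have h1c' : 0 < 1 - c := by linarith
  set q := 2 * (1 + c) / (1 - c) with hqd
  have hq : 2 ≤ q := by
    rw [hqd, le_div_iff₀ h1c']
    linarith
  have hθ : Module.finrank ℝ E5 * (1 / 2 - 1 / q) = 5 * c / (1 + c) := by
    rw [finrank_euclideanSpace_fin, hqd]
    push_cast
    field_simp
    ring
  have hθ1 : 5 * c / (1 + c) < 1 := by
    rw [div_lt_one h1c]
    linarith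
  obtain ⟨K, hK, hGN⟩ := lintegral_rpow_le_interpolation_ball (E := E5) (F := E5) volume hq
    (by rwa [hθ])
  rw [hθ] at hGN
  refine ⟨K, hK, fun ρ hρ u hu hu2 hg2 => ?_⟩
  set B := ball (0 : E5) ρ with hB
  set A := ∫ x in B, ‖u x‖ ^ 2 with hA
  set D := ∫ x in B, gradNormSq u x with hD
  have hA0 : 0 ≤ A := integral_nonneg fun _ => by positivity
  have hD0 : 0 ≤ D := integral_nonneg fun _ => gradNormSq_nonneg u _
  set φ : E5 → ℝ := fun x => (‖u x‖ * √(gradNormSq u x)) ^ (1 + c) with hφ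
  have hφ_zero : φ =ᵐ[volume.restrict B] 0 →
      (∫ x in B, φ x) ^ (1 / (1 + c)) ≤ K * ((A ^ ((1 : ℝ) / 2)) ^ ((1 - 4 * c) / (1 + c)) *
        (D ^ ((1 : ℝ) / 2)) ^ ((1 + 6 * c) / (1 + c)) +
          ρ ^ (-(5 * c) / (1 + c)) * A ^ ((1 : ℝ) / 2) * D ^ ((1 : ℝ) / 2)) := by
    intro h
    rw [integral_congr_ae h]
    simp only [Pi.zero_apply, integral_zero]
    rw [Real.zero_rpow (by positivity)]
    positivity
  rcases hA0.eq_or_lt with hA0 | hA0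
  · apply hφ_zero
    have h := (integral_eq_zero_iff_of_nonneg (fun _ => by positivity) hu2).1 hA0.symm
    filter_upwards [h] with x hx
    have : ‖u x‖ = 0 := by simpa using hx
    simp [hφ, this, Real.zero_rpow h1c.ne']
  rcases hD0.eq_or_lt with hD0 | hD0
  · apply hφ_zero
    have h := (integral_eq_zero_iff_of_nonneg (gradNormSq_nonneg u) hg2).1 hD0.symm
    filter_upwards [h] with x hx
    have : gradNormSq u x = 0 := hx
    simp [hφ, this, Real.zero_rpow h1c.ne']
  set a := A ^ ((1 : ℝ) / 2) with ha
  set b := D ^ ((1 : ℝ) / 2) with hb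
  have ha0 : 0 < a := by positivity
  have hb0 : 0 < b := by positivity
  have haA : a ^ 2 = A := by
    rw [ha, ← Real.sqrt_eq_rpow, Real.sq_sqrt hA0.le]
  have hbD : b ^ 2 = D := by
    rw [hb, ← Real.sqrt_eq_rpow, Real.sq_sqrt hD0.le]
  have hsq : ∀ r : ℝ, 0 ≤ r → ENNReal.ofReal (r ^ 2) = ENNReal.ofReal r ^ (2 : ℝ) := fun r hr => by
    rw [ENNReal.ofReal_rpow_of_nonneg hr zero_le_two, Real.rpow_two]
  have hua : ∫⁻ x in B, ‖u x‖ₑ ^ (2 : ℝ) = ENNReal.ofReal (a ^ 2) := by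
    rw [haA, hA, ofReal_integral_eq_lintegral_ofReal hu2 (.of_forall fun _ => by positivity)]
    refine lintegral_congr fun x => ?_
    rw [hsq _ (norm_nonneg _), ofReal_norm]
  have hgb : ∫⁻ x in B, ENNReal.ofReal √(gradNormSq u x) ^ (2 : ℝ) = ENNReal.ofReal (b ^ 2) := by
    rw [hbD, hD, ofReal_integral_eq_lintegral_ofReal hg2 (.of_forall (gradNormSq_nonneg u))]
    refine lintegral_congr fun x => ?_
    rw [← hsq _ (Real.sqrt_nonneg _), Real.sq_sqrt (gradNormSq_nonneg u x)]
  have hub : ∫⁻ x in B, ‖fderiv ℝ u x‖ₑ ^ (2 : ℝ) ≤ ENNReal.ofReal (b ^ 2) := by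
    rw [← hgb]
    refine lintegral_mono fun x => ?_
    rw [← ofReal_norm]
    gcongr
    exact norm_fderiv_le_sqrt_gradNormSq u x
  have hum : AEStronglyMeasurable u (volume.restrict B) :=
    ContinuousOn.aestronglyMeasurable
      (fun x hx => (hu x hx).continuousAt.continuousWithinAt) measurableSet_ball
  have hgm : Measurable fun x => √(gradNormSq u x) := (measurable_gradNormSq u).sqrt
  have hφm : AEStronglyMeasurable φ (volume.restrict B) :=
    ((hum.norm.aemeasurable.mul hgm.aemeasurable).pow_const _).aestronglyMeasurable
  have hφl : ∫⁻ x in B, ENNReal.ofReal (φ x) =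
      ∫⁻ x in B, (‖u x‖ₑ * ENNReal.ofReal √(gradNormSq u x)) ^ (1 + c) := by
    refine lintegral_congr fun x => ?_
    rw [hφ, ← ENNReal.ofReal_rpow_of_nonneg (by positivity) h1c.le,
      ENNReal.ofReal_mul (norm_nonneg _), ofReal_norm]
  rw [integral_eq_lintegral_of_nonneg_ae (.of_forall fun _ => by positivity) hφm,
    ENNReal.toReal_rpow]
  refine ENNReal.toReal_le_of_le_ofReal (by positivity) ?_
  calc (∫⁻ x in B, ENNReal.ofReal (φ x)) ^ (1 / (1 + c))
      ≤ (∫⁻ x in B, ‖u x‖ₑ ^ q) ^ (1 / q) *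
        (∫⁻ x in B, ENNReal.ofReal √(gradNormSq u x) ^ (2 : ℝ)) ^ (1 / 2 : ℝ) := by
        rw [hφl]
        exact lintegral_convection_rpow_le hc1.le (by linarith) hum.enorm
          hgm.ennreal_ofReal.aemeasurable
    _ ≤ ENNReal.ofReal (K * (a ^ (1 - 5 * c / (1 + c)) * b ^ (5 * c / (1 + c)) +
          ρ ^ (-(5 * c / (1 + c))) * a)) * ENNReal.ofReal b := by
        rw [hgb, hsq b hb0.le, ← ENNReal.rpow_mul, mul_one_div_cancel two_ne_zero,
          ENNReal.rpow_one]
        gcongr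
        exact hGN ρ hρ u hu a ha0 hua.le b hb0 hub
    _ = _ := by
        rw [← ENNReal.ofReal_mul (by positivity)]
        congr 1
        have e1 : (1 + 6 * c) / (1 + c) = 5 * c / (1 + c) + 1 := by
          field_simp
          ring
        have e2 : (1 - 4 * c) / (1 + c) = 1 - 5 * c / (1 + c) := by
          field_simp
          ring
        rw [e1, e2, Real.rpow_add hb0, Real.rpow_one, neg_div]
        ring
end
end

section
/- Let v be a harmonic function on the ball B(x,ρ) ⊂ ℝ^5 (i.e., v is smooth with Δv = 0 there), and let γ ∈ (0, 1). Then there is a dimensional constant N > 0, independent of v, x, ρ, and γ, such that ∫_{B(x,γρ)} |v − (v)_{B(x,γρ)}|² dy ≤ N γ^7 ∫_{B(x,ρ)} |v − (v)_{B(x,ρ)}|² dy. -/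
open MeasureTheory Metric Real NNReal

noncomputable section

/-- The Lipschitz radial weight `(1 - |z|²)₊`, supported in the closed unit ball. -/
def radialWeight (z : E5) : ℝ := max 0 (1 - ‖z‖ ^ 2)

/-- A potential of the radial field `z ↦ radialWeight z • z`. -/
def radialPotential (z : E5) : ℝ := -(radialWeight z ^ 2 / 4)

lemma radialWeight_eq_zero {z : E5} (hz : 1 ≤ ‖z‖) : radialWeight z = 0 := by
  unfold radialWeight
  exact max_eq_left (by nlinarith)

lemma continuous_radialWeight : Continuous radialWeight := by
  unfold radialWeight
  fun_prop

lemma radialWeight_nonneg (z : E5) : 0 ≤ radialWeight z := le_max_left _ _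

lemma radialWeight_eq_one_sub_min_sq (z : E5) : radialWeight z = 1 - min 1 ‖z‖ ^ 2 := by
  rcases le_total 1 ‖z‖ with h | h
  · rw [radialWeight_eq_zero h, min_eq_left h]
    norm_num
  · rw [min_eq_right h, radialWeight, max_eq_right]
    nlinarith [norm_nonneg z]

lemma abs_radialWeight_sub_le (z w : E5) :
    |radialWeight z - radialWeight w| ≤ 2 * ‖z - w‖ := by
  rw [radialWeight_eq_one_sub_min_sq, radialWeight_eq_one_sub_min_sq]
  have h1 : |min 1 ‖w‖ - min 1 ‖z‖| ≤ ‖z - w‖ := by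
    refine (abs_min_sub_min_le_max 1 ‖w‖ 1 ‖z‖).trans (max_le (by simp) ?_)
    rw [norm_sub_rev]
    exact abs_norm_sub_norm_le w z
  have h2 : |min 1 ‖w‖ + min 1 ‖z‖| ≤ 2 := by
    rw [abs_of_nonneg (by positivity)]
    linarith [min_le_left 1 ‖w‖, min_le_left 1 ‖z‖]
  calc |1 - min 1 ‖z‖ ^ 2 - (1 - min 1 ‖w‖ ^ 2)|
      = |min 1 ‖w‖ + min 1 ‖z‖| * |min 1 ‖w‖ - min 1 ‖z‖| := by
        rw [← abs_mul]
        congr 1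
        ring
    _ ≤ 2 * ‖z - w‖ := by gcongr

lemma integral_radialWeight_pos : 0 < ∫ z, radialWeight z := by
  refine continuous_radialWeight.integral_pos_of_hasCompactSupport_nonneg_nonzero (x := 0)
    ?_ radialWeight_nonneg (by simp [radialWeight])
  refine HasCompactSupport.intro (isCompact_closedBall (0 : E5) 1) fun z hz => ?_
  exact radialWeight_eq_zero (by simpa using (not_le.1 (by simpa using hz)).le)

lemma hasDerivAt_max_zero_sq (s : ℝ) :
    HasDerivAt (fun s : ℝ => max 0 s ^ 2) (2 * max 0 s) s := by
  rcases lt_trichotomy s 0 with h | rfl | h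
  · rw [max_eq_left h.le, mul_zero]
    refine (hasDerivAt_const s (0 : ℝ)).congr_of_eventuallyEq ?_
    filter_upwards [gt_mem_nhds h] with r hr
    simp [max_eq_left hr.le]
  · rw [hasDerivAt_iff_isLittleO_nhds_zero]
    have : (fun h : ℝ => h ^ 2) =o[nhds 0] fun h : ℝ => h := by
      simpa using Asymptotics.isLittleO_pow_id (𝕜 := ℝ) one_lt_two
    refine Asymptotics.IsBigO.trans_isLittleO (Asymptotics.IsBigO.of_bound 1 ?_) this
    refine Filter.Eventually.of_forall fun r => ?_
    rcases le_total 0 r with hr | hr <;> simp [hr]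
    positivity
  · rw [max_eq_right h.le]
    have h2 : HasDerivAt (fun s : ℝ => s ^ 2) (2 * s) s := by simpa using hasDerivAt_pow 2 s
    refine h2.congr_of_eventuallyEq ?_
    filter_upwards [lt_mem_nhds h] with r hr
    simp [max_eq_right hr.le]

lemma hasFDerivAt_radialPotential (z : E5) :
    HasFDerivAt radialPotential (radialWeight z • innerSL ℝ z) z := by
  have h1 : HasFDerivAt (fun z : E5 => 1 - ‖z‖ ^ 2) (-(2 • innerSL ℝ z)) z := by
    simpa using (hasFDerivAt_id z).norm_sq.const_sub 1
  have h2 := ((hasDerivAt_max_zero_sq (1 - ‖z‖ ^ 2)).comp_hasFDerivAt z h1).const_mul (-(1 / 4))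
  refine (h2.congr_fderiv ?_).congr_of_eventuallyEq (Filter.Eventually.of_forall fun w => ?_)
  · ext w
    simp [radialWeight]
    ring
  · simp [radialPotential, radialWeight]
    ring

lemma continuous_radialPotential : Continuous radialPotential :=
  continuous_iff_continuousAt.2 fun z => (hasFDerivAt_radialPotential z).continuousAt

lemma inner_eb (z : E5) (i : Fin 5) : inner ℝ z (eb i) = z i := by
  simp [eb, EuclideanSpace.inner_single_right]

lemma setIntegral_radialWeight_mul_add {U : Set E5} (hU : IsOpen U)
    (hU1 : closedBall 0 1 ⊆ U) {f : E5 → ℝ} (hf : ContDiffOn ℝ 1 f U) (i : Fin 5) :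
    ∫ z in closedBall (0 : E5) 1,
      (radialWeight z * z i * f z + radialPotential z * fderiv ℝ f z (eb i)) = 0 := by
  have hfd : ContinuousOn (fun z => fderiv ℝ f z (eb i)) U :=
    (hf.continuousOn_fderiv_of_isOpen hU le_rfl).clm_apply continuousOn_const
  have hout : ∀ z : E5, z ∉ closedBall (0 : E5) 1 → 1 < ‖z‖ := fun z hz => by
    simpa using hz
  have hP0 : ∀ z : E5, z ∉ closedBall (0 : E5) 1 → radialPotential z = 0 := fun z hz => by
    simp [radialPotential, radialWeight_eq_zero (hout z hz).le]
  have hcont : ∀ g : E5 → ℝ, ContinuousOn g U → (∀ z ∉ closedBall (0 : E5) 1, g z = 0) →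
      Integrable g := fun g hg h0 =>
    ((hg.mono hU1).integrableOn_compact
      (isCompact_closedBall _ _)).integrable_of_forall_notMem_eq_zero h0
  let G' : E5 → E5 →L[ℝ] ℝ := fun z =>
    radialPotential z • fderiv ℝ f z + f z • (radialWeight z • innerSL ℝ z)
  have hG : ∀ z, HasFDerivAt (fun z => radialPotential z * f z) (G' z) z := by
    intro z
    by_cases hz : z ∈ closedBall (0 : E5) 1
    · exact (hasFDerivAt_radialPotential z).mul
        ((hf.differentiableOn one_ne_zero).differentiableAt
          (hU.mem_nhds (hU1 hz))).hasFDerivAt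
    · have : G' z = 0 := by
        simp [G', hP0 z hz, radialWeight_eq_zero (hout z hz).le]
      rw [this]
      refine (hasFDerivAt_const (0 : ℝ) z).congr_of_eventuallyEq ?_
      filter_upwards [isClosed_closedBall.isOpen_compl.mem_nhds hz] with w hw
      simp [hP0 w hw]
  have hG'e : ∀ z, G' z (eb i) =
      radialWeight z * z i * f z + radialPotential z * fderiv ℝ f z (eb i) := fun z => by
    simp [G', inner_eb]
    ring
  have hcoord : Continuous fun z : E5 => z i := by fun_prop
  have hG'0 : ∀ z ∉ closedBall (0 : E5) 1, G' z (eb i) = 0 := fun z hz => by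
    rw [hG'e, hP0 z hz, radialWeight_eq_zero (hout z hz).le]
    ring
  have hG'int : Integrable fun z => G' z (eb i) := by
    refine hcont _ ?_ hG'0
    simp only [hG'e]
    exact (((continuous_radialWeight.mul hcoord).continuousOn).mul hf.continuousOn).add
      (continuous_radialPotential.continuousOn.mul hfd)
  have key := integral_bilinear_hasFDerivAt_right_eq_neg_left_of_integrable (μ := volume)
    (B := ContinuousLinearMap.mul ℝ ℝ) (f := fun _ : E5 => (1 : ℝ)) (f' := fun _ => 0)
    (g := fun z => radialPotential z * f z) (g' := G') (v := eb i)
    (by simp) (by simpa using hG'int)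
    (by
      simp only [ContinuousLinearMap.mul_apply', one_mul]
      exact hcont _ (continuous_radialPotential.continuousOn.mul hf.continuousOn)
        fun z hz => by simp [hP0 z hz])
    (fun z _ => hasFDerivAt_const _ _) (fun z _ => hG z)
  simp only [← hG'e]
  rw [setIntegral_eq_integral_of_forall_compl_eq_zero hG'0]
  simpa using key

lemma clm_apply_eq_sum (L : E5 →L[ℝ] ℝ) (z : E5) : L z = ∑ i, z i * L (eb i) := by
  conv_lhs => rw [← (EuclideanSpace.basisFun (Fin 5) ℝ).sum_repr z]
  simp [eb]

/-- The weighted mean value property of harmonic functions. -/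
lemma integral_radialWeight_mul_harmonic {x : E5} {ρ : ℝ} {v : E5 → ℝ}
    (hv : ContDiffOn ℝ (⊤ : ℕ∞) v (ball x ρ)) (hlap : ∀ y ∈ ball x ρ, lap v y = 0)
    {y : E5} {R : ℝ} (hR : 0 ≤ R) (hyR : dist y x + R < ρ) :
    ∫ z in closedBall (0 : E5) 1, radialWeight z * v (y + R • z) =
      (∫ z, radialWeight z) * v y := by
  set R' := ρ - dist y x with hR'
  have hmem : ∀ t z, |t| * ‖z‖ < R' → y + t • z ∈ ball x ρ := by
    intro t z h
    rw [mem_ball, dist_eq_norm]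
    have : y + t • z - x = (y - x) + t • z := by abel
    rw [this]
    refine (norm_add_le _ _).trans_lt ?_
    rw [norm_smul, Real.norm_eq_abs, ← dist_eq_norm]
    linarith
  have hmem1 : ∀ t z, |t| < R' → z ∈ closedBall (0 : E5) 1 → y + t • z ∈ ball x ρ := by
    intro t z ht hz
    refine hmem t z (lt_of_le_of_lt ?_ ht)
    exact mul_le_of_le_one_right (abs_nonneg t) (by simpa using hz)
  have hdiff : ∀ p ∈ ball x ρ, DifferentiableAt ℝ v p := fun p hp =>
    (hv.differentiableOn (by simp)).differentiableAt (isOpen_ball.mem_nhds hp)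
  have hDv : ContDiffOn ℝ 1 (fderiv ℝ v) (ball x ρ) :=
    hv.fderiv_of_isOpen isOpen_ball (by norm_cast)
  have hline : ∀ t, |t| < R' →
      Set.MapsTo (fun z => y + t • z) (closedBall (0 : E5) 1) (ball x ρ) :=
    fun t ht z hz => hmem1 t z ht hz
  have hFcont : ∀ t, |t| < R' → ContinuousOn (fun z => radialWeight z * v (y + t • z))
      (closedBall (0 : E5) 1) := fun t ht =>
    continuous_radialWeight.continuousOn.mul
      (hv.continuousOn.comp (by fun_prop) (hline t ht))
  have hF'cont : ∀ t, |t| < R' →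
      ContinuousOn (fun z => radialWeight z * fderiv ℝ v (y + t • z) z)
      (closedBall (0 : E5) 1) := fun t ht =>
    continuous_radialWeight.continuousOn.mul
      ((hDv.continuousOn.comp (by fun_prop) (hline t ht)).clm_apply continuousOn_id)
  have hderiv : ∀ t, |t| < R' →
      HasDerivAt (fun t => ∫ z in closedBall (0 : E5) 1, radialWeight z * v (y + t • z))
        (∫ z in closedBall (0 : E5) 1, radialWeight z * fderiv ℝ v (y + t • z) z) t := by
    intro t ht
    obtain ⟨r, htr, hrR⟩ := exists_between ht
    have hr0 : 0 ≤ r := (abs_nonneg t).trans htr.le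
    have hsub : closedBall y r ⊆ ball x ρ := by
      refine closedBall_subset_ball' ?_
      linarith
    obtain ⟨M, hM⟩ := (isCompact_closedBall y r).exists_bound_of_continuousOn
      (hDv.continuousOn.mono hsub)
    obtain ⟨K, hK⟩ := (isCompact_closedBall (0 : E5) 1).exists_bound_of_continuousOn
      continuous_radialWeight.continuousOn
    refine (hasDerivAt_integral_of_dominated_loc_of_deriv_le (s := ball (0 : ℝ) r)
      (F' := fun t z => radialWeight z * fderiv ℝ v (y + t • z) z)
      (bound := fun _ => K * M) (isOpen_ball.mem_nhds (by simpa using htr)) ?_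
      ((hFcont t ht).integrableOn_compact (isCompact_closedBall _ _))
      ((hF'cont t ht).aestronglyMeasurable measurableSet_closedBall) ?_ ?_ ?_).2
    · have : {s : ℝ | |s| < R'} ∈ nhds t :=
        (isOpen_lt continuous_abs continuous_const).mem_nhds ht
      filter_upwards [this] with s hs
      exact (hFcont s hs).aestronglyMeasurable measurableSet_closedBall
    · refine (ae_restrict_iff' measurableSet_closedBall).2 (Filter.Eventually.of_forall ?_)
      intro z hz s hs
      have hs' : |s| < r := by simpa using hs
      have hz' : ‖z‖ ≤ 1 := by simpa using hz
      have h1 : ‖fderiv ℝ v (y + s • z) z‖ ≤ M := by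
        have hin : y + s • z ∈ closedBall y r := by
          simp only [mem_closedBall, dist_eq_norm, add_sub_cancel_left, norm_smul,
            Real.norm_eq_abs]
          nlinarith [abs_nonneg s]
        refine ((fderiv ℝ v (y + s • z)).le_opNorm z).trans ?_
        exact (mul_le_of_le_one_right (norm_nonneg _) hz').trans (hM _ hin)
      rw [norm_mul]
      exact mul_le_mul (hK z hz) h1 (norm_nonneg _) ((norm_nonneg _).trans (hK z hz))
    · exact integrableOn_const (measure_closedBall_lt_top).ne
    · refine (ae_restrict_iff' measurableSet_closedBall).2 (Filter.Eventually.of_forall ?_)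
      intro z hz s hs
      have hs' : |s| < R' := lt_trans (by simpa using hs) hrR
      have h1 : HasDerivAt (fun s : ℝ => y + s • z) z s := by
        simpa using ((hasDerivAt_id s).smul_const z).const_add y
      exact ((hdiff _ (hmem1 s z hs' hz)).hasFDerivAt.comp_hasDerivAt s h1).const_mul _
  have hzero : ∀ t, |t| < R' →
      ∫ z in closedBall (0 : E5) 1, radialWeight z * fderiv ℝ v (y + t • z) z = 0 := by
    intro t ht
    set U : Set E5 := (fun z => y + t • z) ⁻¹' ball x ρ with hUdef
    have hU : IsOpen U := isOpen_ball.preimage (by fun_prop)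
    have hU1 : closedBall (0 : E5) 1 ⊆ U := hline t ht
    have hX : ∀ i, ContDiffOn ℝ 1 (fun p => fderiv ℝ v p (eb i)) (ball x ρ) := fun i =>
      hDv.clm_apply contDiffOn_const
    have hf : ∀ i, ContDiffOn ℝ 1 (fun z => fderiv ℝ v (y + t • z) (eb i)) U := fun i =>
      (hX i).comp (by fun_prop) fun z hz => hz
    have hfd : ∀ i, ∀ z ∈ U, fderiv ℝ (fun z => fderiv ℝ v (y + t • z) (eb i)) z (eb i) =
        t * fderiv ℝ (fun p => fderiv ℝ v p (eb i)) (y + t • z) (eb i) := by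
      intro i z hz
      have h1 : HasFDerivAt (fun z : E5 => y + t • z) (t • ContinuousLinearMap.id ℝ E5) z :=
        ((hasFDerivAt_id z).const_smul t).const_add y
      have h2 := (((hX i).differentiableOn one_ne_zero).differentiableAt
        (isOpen_ball.mem_nhds hz)).hasFDerivAt.comp z h1
      rw [HasFDerivAt.fderiv (f := fun z => fderiv ℝ v (y + t • z) (eb i)) h2]
      simp
    have hint : ∀ i, IntegrableOn (fun z => radialWeight z * z i * fderiv ℝ v (y + t • z) (eb i)
        + radialPotential z * fderiv ℝ (fun z => fderiv ℝ v (y + t • z) (eb i)) z (eb i))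
        (closedBall (0 : E5) 1) := by
      intro i
      refine ContinuousOn.integrableOn_compact (isCompact_closedBall _ _) (ContinuousOn.mono ?_ hU1)
      have hcoord : Continuous fun z : E5 => z i := by fun_prop
      exact ((continuous_radialWeight.mul hcoord).continuousOn.mul (hf i).continuousOn).add
        (continuous_radialPotential.continuousOn.mul
          (((hf i).continuousOn_fderiv_of_isOpen hU le_rfl).clm_apply continuousOn_const))
    have hsum := Finset.sum_eq_zero fun i (_ : i ∈ Finset.univ) =>
      setIntegral_radialWeight_mul_add hU hU1 (hf i) i
    rw [← integral_finsetSum _ fun i _ => hint i] at hsum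
    rw [← hsum]
    refine setIntegral_congr_fun measurableSet_closedBall fun z hz => ?_
    have hl := hlap _ (hmem1 t z ht hz)
    rw [lap] at hl
    simp only [hfd _ z (hU1 hz)]
    rw [Finset.sum_add_distrib, ← Finset.mul_sum, ← Finset.mul_sum, hl, clm_apply_eq_sum]
    simp [Finset.mul_sum, mul_assoc]
  have hconst := IsOpen.is_const_of_deriv_eq_zero (isOpen_ball (x := (0 : ℝ)) (ε := R'))
    (convex_ball _ _).isPreconnected
    (f := fun t => ∫ z in closedBall (0 : E5) 1, radialWeight z * v (y + t • z))
    (fun t ht => (hderiv t (by simpa using ht)).differentiableAt.differentiableWithinAt)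
    (fun t ht => by
      have ht' : |t| < R' := by simpa using ht
      simp [(hderiv t ht').deriv, hzero t ht'])
    (x := R) (y := 0) (by simp [abs_of_nonneg hR]; linarith) (by simp; linarith)
  beta_reduce at hconst
  rw [hconst]
  simp only [zero_smul, add_zero]
  rw [integral_mul_const, setIntegral_eq_integral_of_forall_compl_eq_zero]
  intro z hz
  exact radialWeight_eq_zero (by simpa using (not_le.1 (by simpa using hz)).le)

lemma setIntegral_radialWeight_rescale {x y : E5} {ρ R : ℝ} (hR : 0 < R)
    (hyR : dist y x + R < ρ) (u : E5 → ℝ) :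
    ∫ z in closedBall (0 : E5) 1, radialWeight z * u (y + R • z) =
      (R ^ 5)⁻¹ * ∫ w in ball x ρ, radialWeight (R⁻¹ • (w - y)) * u w := by
  set h : E5 → ℝ := fun w => radialWeight (R⁻¹ • (w - y)) * u w with hh
  have h1 : ∀ z, radialWeight z * u (y + R • z) = h (y + R • z) := fun z => by
    simp [hh, smul_smul, inv_mul_cancel₀ hR.ne']
  rw [setIntegral_eq_integral_of_forall_compl_eq_zero,
    setIntegral_eq_integral_of_forall_compl_eq_zero]
  · simp only [h1]
    rw [Measure.integral_comp_smul volume (fun z => h (y + z)) R, integral_add_left_eq_self]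
    simp [abs_of_pos hR, hh]
  · intro w hw
    have hw' : ρ ≤ dist w x := by simpa using hw
    rw [radialWeight_eq_zero, zero_mul]
    rw [norm_smul, norm_inv, Real.norm_eq_abs, abs_of_pos hR, ← dist_eq_norm,
      inv_mul_eq_div, one_le_div hR]
    linarith [dist_triangle w y x]
  · intro z hz
    rw [radialWeight_eq_zero (by simpa using (not_le.1 (by simpa using hz)).le), zero_mul]

/-- Interior Lipschitz estimate for harmonic functions in terms of the `L¹` norm. -/
lemma abs_sub_le_of_harmonic {x y : E5} {ρ R : ℝ} {u : E5 → ℝ}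
    (hu : ContDiffOn ℝ (⊤ : ℕ∞) u (ball x ρ)) (hlap : ∀ y ∈ ball x ρ, lap u y = 0)
    (hint : IntegrableOn u (ball x ρ)) (hR : 0 < R) (hyR : dist y x + R < ρ) :
    (∫ z, radialWeight z) * |u y - u x| ≤
      (R ^ 5)⁻¹ * (2 * (R⁻¹ * dist y x)) * ∫ w in ball x ρ, |u w| := by
  have hxR : dist x x + R < ρ := by
    rw [dist_self]
    linarith [dist_nonneg (x := y) (y := x)]
  have hbd : ∀ p : E5, IntegrableOn (fun w => radialWeight (R⁻¹ • (w - p)) * u w) (ball x ρ) := by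
    intro p
    have hc : Continuous fun w : E5 => radialWeight (R⁻¹ • (w - p)) :=
      continuous_radialWeight.comp (by fun_prop)
    refine Integrable.bdd_mul (c := 1) hint hc.aestronglyMeasurable
      (Filter.Eventually.of_forall fun w => ?_)
    rw [Real.norm_eq_abs, abs_of_nonneg (radialWeight_nonneg _)]
    exact max_le zero_le_one (by linarith [sq_nonneg ‖R⁻¹ • (w - p)‖])
  have hpoint : ∀ w, ‖radialWeight (R⁻¹ • (w - y)) * u w - radialWeight (R⁻¹ • (w - x)) * u w‖ ≤
      2 * (R⁻¹ * dist y x) * |u w| := by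
    intro w
    rw [← sub_mul, norm_mul, Real.norm_eq_abs, Real.norm_eq_abs]
    gcongr
    refine (abs_radialWeight_sub_le _ _).trans_eq ?_
    rw [← smul_sub, norm_smul, norm_inv, Real.norm_eq_abs, abs_of_pos hR, sub_sub_sub_cancel_left,
      dist_comm y x, dist_eq_norm]
  have hmv := fun {p : E5} (hp : dist p x + R < ρ) =>
    (integral_radialWeight_mul_harmonic hu hlap hR.le hp).symm.trans
      (setIntegral_radialWeight_rescale hR hp u)
  have hc := integral_radialWeight_pos
  calc (∫ z, radialWeight z) * |u y - u x|
      = |(∫ z, radialWeight z) * u y - (∫ z, radialWeight z) * u x| := by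
        rw [← mul_sub, abs_mul, abs_of_pos hc]
    _ = (R ^ 5)⁻¹ * ‖∫ w in ball x ρ, (radialWeight (R⁻¹ • (w - y)) * u w -
          radialWeight (R⁻¹ • (w - x)) * u w)‖ := by
        rw [hmv hyR, hmv hxR, ← mul_sub, abs_mul, abs_of_pos (by positivity),
          integral_sub (hbd y) (hbd x), Real.norm_eq_abs]
    _ ≤ (R ^ 5)⁻¹ * ∫ w in ball x ρ, 2 * (R⁻¹ * dist y x) * |u w| := by
        gcongr
        exact norm_integral_le_of_norm_le (hint.abs.const_mul _)
          (Filter.Eventually.of_forall hpoint)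
    _ = _ := by rw [integral_const_mul, ← mul_assoc]

lemma setIntegral_sub_const_sq {s : Set E5} {g : E5 → ℝ} (hs : volume s ≠ ⊤)
    (hg : IntegrableOn g s) (hg2 : IntegrableOn (fun y => g y ^ 2) s) (b : ℝ) :
    ∫ y in s, (g y - b) ^ 2 =
      (∫ y in s, g y ^ 2) - 2 * b * (∫ y in s, g y) + b ^ 2 * volume.real s := by
  have h : ∀ y, (g y - b) ^ 2 = g y ^ 2 - 2 * b * g y + b ^ 2 := fun y => by ring
  simp only [h]
  have h1 : Integrable (fun y => 2 * b * g y) (volume.restrict s) := Integrable.const_mul hg _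
  have h2 : Integrable (fun y => g y ^ 2 - 2 * b * g y) (volume.restrict s) :=
    Integrable.sub hg2 h1
  rw [integral_add h2 (integrableOn_const hs), integral_sub hg2 h1, integral_const_mul,
    setIntegral_const, smul_eq_mul, mul_comm (volume.real s)]

lemma setIntegral_sub_avgOn_sq_le {s : Set E5} {g : E5 → ℝ} (hs : volume s ≠ ⊤)
    (hs0 : 0 < volume.real s) (hg : IntegrableOn g s)
    (hg2 : IntegrableOn (fun y => g y ^ 2) s) (b : ℝ) :
    ∫ y in s, (g y - avgOn s g) ^ 2 ≤ ∫ y in s, (g y - b) ^ 2 := by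
  rw [setIntegral_sub_const_sq hs hg hg2, setIntegral_sub_const_sq hs hg hg2]
  have h : ∫ y in s, g y = volume.real s * avgOn s g := by
    rw [avgOn, setAverage_eq, smul_eq_mul, mul_inv_cancel_left₀ hs0.ne']
  rw [h]
  nlinarith [mul_nonneg hs0.le (sq_nonneg (avgOn s g - b))]

lemma sq_setIntegral_le {s : Set E5} {g : E5 → ℝ} (hs : volume s ≠ ⊤)
    (hs0 : 0 < volume.real s) (hg : IntegrableOn g s)
    (hg2 : IntegrableOn (fun y => g y ^ 2) s) :
    (∫ y in s, g y) ^ 2 ≤ volume.real s * ∫ y in s, g y ^ 2 := by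
  have h0 : 0 ≤ ∫ y in s, (g y - avgOn s g) ^ 2 := integral_nonneg fun y => sq_nonneg _
  rw [setIntegral_sub_const_sq hs hg hg2] at h0
  have h : ∫ y in s, g y = volume.real s * avgOn s g := by
    rw [avgOn, setAverage_eq, smul_eq_mul, mul_inv_cancel_left₀ hs0.ne']
  rw [h] at h0 ⊢
  nlinarith [mul_nonneg hs0.le h0]

lemma volume_real_ball (x : E5) {r : ℝ} (hr : 0 ≤ r) :
    volume.real (ball x r) = r ^ 5 * volume.real (ball (0 : E5) 1) := by
  rw [Measure.real, Measure.addHaar_ball volume x hr, ENNReal.toReal_mul,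
    ENNReal.toReal_ofReal (by positivity), Measure.real]
  simp

lemma volume_real_ball_pos (x : E5) {r : ℝ} (hr : 0 < r) : 0 < volume.real (ball x r) :=
  ENNReal.toReal_pos (measure_ball_pos volume x hr).ne' measure_ball_lt_top.ne

lemma lap_sub_const (v : E5 → ℝ) (a : ℝ) : lap (fun y => v y - a) = lap v := by
  have h : fderiv ℝ (fun y => v y - a) = fderiv ℝ v := funext fun y => fderiv_sub_const a
  ext y
  simp only [lap, h]

lemma integrableOn_of_integrableOn_sq {s : Set E5} {v : E5 → ℝ} (hs : volume s ≠ ⊤)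
    (hsm : MeasurableSet s) (hv : ContinuousOn v s)
    (hv2 : IntegrableOn (fun y => v y ^ 2) s) : IntegrableOn v s := by
  have : IsFiniteMeasure (volume.restrict s) := ⟨by simpa using hs.lt_top⟩
  exact ((memLp_two_iff_integrable_sq (hv.aestronglyMeasurable hsm)).2 hv2).integrable one_le_two

lemma setIntegral_sub_center_sq_le {x : E5} {ρ γ : ℝ} {u : E5 → ℝ} (hρ : 0 < ρ) (hγ : 0 < γ)
    (hγ2 : γ ≤ 1 / 2) (hu : ContDiffOn ℝ (⊤ : ℕ∞) u (ball x ρ))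
    (hlap : ∀ y ∈ ball x ρ, lap u y = 0) (hu2 : IntegrableOn (fun y => u y ^ 2) (ball x ρ)) :
    ∫ y in ball x (γ * ρ), (u y - u x) ^ 2 ≤
      (128 * volume.real (ball (0 : E5) 1) / ∫ z, radialWeight z) ^ 2 * γ ^ 7 *
        ∫ y in ball x ρ, u y ^ 2 := by
  have hγρ : γ * ρ ≤ ρ / 2 := by nlinarith
  have hu1 : IntegrableOn u (ball x ρ) :=
    integrableOn_of_integrableOn_sq measure_ball_lt_top.ne measurableSet_ball hu.continuousOn hu2
  have hI := sq_setIntegral_le (g := fun y => |u y|) measure_ball_lt_top.ne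
    (volume_real_ball_pos x hρ) hu1.abs (by simpa using hu2)
  simp only [sq_abs] at hI
  rw [volume_real_ball x hρ.le] at hI
  set c := ∫ z, radialWeight z with hc
  set ω := volume.real (ball (0 : E5) 1) with hω
  set I := ∫ y in ball x ρ, |u y| with hIdef
  set J := ∫ y in ball x ρ, u y ^ 2 with hJ
  have hc0 : 0 < c := integral_radialWeight_pos
  have hI0 : 0 ≤ I := integral_nonneg fun y => abs_nonneg _
  have hpt : ∀ y ∈ ball x (γ * ρ), (u y - u x) ^ 2 ≤ 128 ^ 2 * γ ^ 2 * ω * J / (c ^ 2 * ρ ^ 5) := by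
    intro y hy
    have hy' : dist y x < γ * ρ := hy
    have h1 := abs_sub_le_of_harmonic hu hlap hu1 (R := ρ / 2) (half_pos hρ)
      (y := y) (by linarith)
    have h2 : c * |u y - u x| ≤ 128 * γ * I / ρ ^ 5 := by
      refine h1.trans ?_
      calc ((ρ / 2) ^ 5)⁻¹ * (2 * ((ρ / 2)⁻¹ * dist y x)) * I
          ≤ ((ρ / 2) ^ 5)⁻¹ * (2 * ((ρ / 2)⁻¹ * (γ * ρ))) * I := by gcongr
        _ = 128 * γ * I / ρ ^ 5 := by
          field_simp
          ring
    have h3 : (c * |u y - u x|) ^ 2 ≤ (128 * γ * I / ρ ^ 5) ^ 2 := by gcongr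
    rw [mul_pow, sq_abs] at h3
    rw [le_div_iff₀ (by positivity)]
    calc (u y - u x) ^ 2 * (c ^ 2 * ρ ^ 5) = c ^ 2 * (u y - u x) ^ 2 * ρ ^ 5 := by ring
      _ ≤ (128 * γ * I / ρ ^ 5) ^ 2 * ρ ^ 5 := by gcongr
      _ = 128 ^ 2 * γ ^ 2 * I ^ 2 / ρ ^ 5 := by field_simp
      _ ≤ 128 ^ 2 * γ ^ 2 * (ρ ^ 5 * ω * J) / ρ ^ 5 := by gcongr
      _ = 128 ^ 2 * γ ^ 2 * ω * J := by field_simp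
  have hle := norm_setIntegral_le_of_norm_le_const (μ := volume) (s := ball x (γ * ρ))
    (f := fun y => (u y - u x) ^ 2) measure_ball_lt_top (fun y hy => by
      simpa only [Real.norm_eq_abs, abs_sq] using hpt y hy)
  refine (le_abs_self _).trans (hle.trans_eq ?_)
  rw [volume_real_ball x (by positivity), ← hω]
  field_simp

/-- **Estimate (3.53).** For a harmonic (and square integrable) function `v` on `B(x,ρ)`
and `γ ∈ (0,1)`, the mean oscillation of `v` on `B(x,γρ)` satisfies
`∫_{B(x,γρ)}|v − (v)_{B(x,γρ)}|² ≤ N γ⁷ ∫_{B(x,ρ)}|v − (v)_{B(x,ρ)}|²` with a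
dimensional constant `N`. -/
theorem harmonic_oscillation_decay :
    ∃ N > (0 : ℝ), ∀ (x : E5) (ρ γ : ℝ) (v : E5 → ℝ),
      0 < ρ → 0 < γ → γ < 1 →
      ContDiffOn ℝ (⊤ : ℕ∞) v (ball x ρ) →
      (∀ y ∈ ball x ρ, lap v y = 0) →
      IntegrableOn (fun y => (v y) ^ 2) (ball x ρ) →
      (∫ y in ball x (γ * ρ), |v y - avgOn (ball x (γ * ρ)) v| ^ 2) ≤
        N * γ ^ 7 * ∫ y in ball x ρ, |v y - avgOn (ball x ρ) v| ^ 2 := by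
  have hc := integral_radialWeight_pos
  set c := ∫ z, radialWeight z with hcdef
  set ω := volume.real (ball (0 : E5) 1) with hω
  refine ⟨(128 * ω / c) ^ 2 + 128, by positivity, ?_⟩
  intro x ρ γ v hρ hγ hγ1 hv hlap hv2
  simp only [sq_abs]
  have hsub : ball x (γ * ρ) ⊆ ball x ρ := ball_subset_ball (by nlinarith)
  have hv1 : IntegrableOn v (ball x ρ) :=
    integrableOn_of_integrableOn_sq measure_ball_lt_top.ne measurableSet_ball hv.continuousOn hv2
  set a := avgOn (ball x ρ) v with ha
  have hu2 : IntegrableOn (fun y => (v y - a) ^ 2) (ball x ρ) := by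
    have h : ∀ y, (v y - a) ^ 2 = v y ^ 2 - 2 * a * v y + a ^ 2 := fun y => by ring
    simp only [h]
    exact (hv2.sub (hv1.const_mul _)).add (integrableOn_const measure_ball_lt_top.ne)
  have hJ : 0 ≤ ∫ y in ball x ρ, (v y - a) ^ 2 := integral_nonneg fun y => sq_nonneg _
  have hmin := setIntegral_sub_avgOn_sq_le (s := ball x (γ * ρ)) measure_ball_lt_top.ne
    (volume_real_ball_pos x (by positivity)) (hv1.mono_set hsub) (hv2.mono_set hsub)
  rcases le_total γ (1 / 2) with hγ2 | hγ2
  · have h := setIntegral_sub_center_sq_le (u := fun y => v y - a) hρ hγ hγ2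
      (hv.sub contDiffOn_const) (by simpa only [lap_sub_const] using hlap) hu2
    simp only [sub_sub_sub_cancel_right] at h
    refine (hmin (v x)).trans (h.trans ?_)
    gcongr
    linarith
  · refine (hmin a).trans ?_
    have h1 : ∫ y in ball x (γ * ρ), (v y - a) ^ 2 ≤ ∫ y in ball x ρ, (v y - a) ^ 2 :=
      setIntegral_mono_set hu2 (Filter.Eventually.of_forall fun y => sq_nonneg _)
        hsub.eventuallyLE
    have h2 : (1 : ℝ) ≤ ((128 * ω / c) ^ 2 + 128) * γ ^ 7 := by
      have h3 : ((1 : ℝ) / 2) ^ 7 ≤ γ ^ 7 := by gcongr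
      nlinarith [mul_nonneg (sq_nonneg (128 * ω / c)) (pow_nonneg hγ.le 7)]
    exact h1.trans (le_mul_of_one_le_left hJ h2)
end
end
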